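/- Let k ≥ 3 and ℓ ∈ [k−1] with (k,ℓ) ≠ (3,1), and set t = ⌊k/(k−ℓ)⌋·(k−ℓ). There exists μ₀ > 0 such that for every μ ∈ (0, μ₀] there exists ε₀ > 0 such that for every ε ∈ (0, ε₀] there exists γ₀ > 0 such that for every γ ∈ (0, γ₀] there exists s₀ such that for every s ≥ s₀ divisible by k−ℓ there exists m₀ such that the following holds for every m ≥ m₀. Let F be an s-vertex k-graph with no isolated vertices and δ*(F) ≥ (1 − 1/t − ε)·s, such that every set of at least s/t vertices contains at least μs² supported pairs, and let F* be a (γ,m)-nearly-regular blow-up of F with |V(F*)| ≡ k (mod k−ℓ). Let e₁, e₂ be two ordered edges of F* that are vertex-disjoint from each other and from the singleton part of F* (if it exists). Then there exists a spanning ℓ-path in F* whose first k vertices are e₁ in order and whose last k vertices are e₂ in order. -/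

import Mathlib

open Finset

/-- The number of supported pairs (supported 2-sets) contained in `A`. -/
def suppPairs {s : ℕ} (E : Finset (Finset (Fin s))) (A : Finset (Fin s)) : ℕ :=
  ((A.powersetCard 2).filter fun p => ∃ e ∈ E, p ⊆ e).card

/-- `e` is an edge of the blow-up of the hypergraph with edge set `S`, where the
vertex `v` is blown up into the part `B v`. -/
def IsBlowUpEdge {n s : ℕ} (S : Finset (Finset (Fin s))) (B : Fin s → Finset (Fin n))
    (e : Finset (Fin n)) : Prop :=
  ∃ f ∈ S, e ⊆ f.biUnion B ∧ ∀ v ∈ f, (e ∩ B v).card = 1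

section Walks

variable {V : Type*} [DecidableEq V] {k : ℕ}

/-- There is a `(k - d)`-walk in the `k`-graph with edge set `F` from the ordered edge `a` to the
ordered edge `b` whose visits, apart from those of the final ordered edge, are counted by `c`. -/
def IsWalk (F : Finset (Finset V)) (d : ℕ) (a b : Fin k → V) (c : V → ℤ) : Prop :=
  ∃ (N : ℕ) (w : ℕ → V), (∀ j : Fin k, w j = a j) ∧ (∀ j : Fin k, w (N * d + j) = b j) ∧
    (∀ i ≤ N, univ.image (fun j : Fin k => w (i * d + j)) ∈ F) ∧
    c = ∑ i ∈ range (N * d), Pi.single (w i) (1 : ℤ)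

/-- The number of times each vertex occurs in the ordered edge `a`. -/
def visits (a : Fin k → V) : V → ℤ := ∑ j, Pi.single (a j) (1 : ℤ)

variable {F : Finset (Finset V)} {d : ℕ} {a b c : Fin k → V}

lemma IsWalk.mono {F' : Finset (Finset V)} (hF : F ⊆ F') {x : V → ℤ} (h : IsWalk F d a b x) :
    IsWalk F' d a b x := by
  obtain ⟨N, w, h1, h2, h3, h4⟩ := h
  exact ⟨N, w, h1, h2, fun i hi => hF (h3 i hi), h4⟩

lemma IsWalk.refl (hk : 0 < k) (ha : univ.image a ∈ F) : IsWalk F d a a 0 := by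
  have key : ∀ j : Fin k, a ⟨(j : ℕ) % k, Nat.mod_lt _ hk⟩ = a j := fun j => by
    congr 1; ext; exact Nat.mod_eq_of_lt j.2
  refine ⟨0, fun i => a ⟨i % k, Nat.mod_lt _ hk⟩, key, ?_, ?_, by simp⟩
  · simpa using key
  · intro i hi
    obtain rfl : i = 0 := by omega
    simpa [key] using ha

lemma IsWalk.trans {x y : V → ℤ} (h : IsWalk F d a b x) (h' : IsWalk F d b c y) :
    IsWalk F d a c (x + y) := by
  obtain ⟨N, w, h1, h2, h3, rfl⟩ := h
  obtain ⟨M, u, g1, g2, g3, rfl⟩ := h'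
  have hlow : ∀ p, p < N * d + k →
      (if p < N * d then w p else u (p - N * d)) = w p := by
    intro p hp
    split_ifs with h
    · rfl
    · have e1 := g1 ⟨p - N * d, by omega⟩
      have e2 := h2 ⟨p - N * d, by omega⟩
      simp only at e1 e2
      rw [e1, ← e2]; congr 1; omega
  refine ⟨N + M, fun p => if p < N * d then w p else u (p - N * d), ?_, ?_, ?_, ?_⟩
  · intro j; exact (hlow _ (by omega)).trans (h1 j)
  · intro j
    beta_reduce
    rw [if_neg (by rw [add_mul]; omega), ← g2 j]; congr 1; rw [add_mul]; omega
  · intro i hi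
    rcases le_or_gt i N with hiN | hiN
    · have := Nat.mul_le_mul_right d hiN
      convert h3 i hiN using 3 with j
      exact hlow _ (by omega)
    · have := Nat.mul_le_mul_right d hiN.le
      convert g3 (i - N) (by omega) using 3 with j
      beta_reduce
      rw [if_neg (by omega), Nat.sub_mul]; congr 1; omega
  · rw [add_mul, sum_range_add]
    congr 1
    · refine sum_congr rfl fun i hi => ?_
      beta_reduce
      rw [if_pos (mem_range.1 hi)]
    · refine sum_congr rfl fun i hi => ?_
      beta_reduce
      rw [if_neg (by omega), Nat.add_sub_cancel_left]

lemma exists_add_mod_eq {n : ℕ} (i : ℕ) {x : ℕ} (hx : x < n) : ∃ y < n, (i + y) % n = x := by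
  have hn : 0 < n := by omega
  refine ⟨(x + (n - i % n)) % n, Nat.mod_lt _ hn, ?_⟩
  have h1 := Nat.mod_lt i hn
  have h2 : i + (x + (n - i % n)) = x + n * (i / n + 1) := by
    have := Nat.div_add_mod i n
    rw [mul_add]; omega
  rw [Nat.add_mod, Nat.mod_mod, ← Nat.add_mod, h2, Nat.add_mul_mod_self_left,
    Nat.mod_eq_of_lt hx]

lemma image_comp_add_mod (hk : 0 < k) (p : ℕ) :
    univ.image (fun j : Fin k => a ⟨(p + j) % k, Nat.mod_lt _ hk⟩) = univ.image a := by
  ext v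
  simp only [mem_image, mem_univ, true_and]
  constructor
  · rintro ⟨j, rfl⟩; exact ⟨_, rfl⟩
  · rintro ⟨j, rfl⟩
    obtain ⟨y, hy, h⟩ := exists_add_mod_eq p j.2
    exact ⟨⟨y, hy⟩, by simp [h]⟩

lemma sum_range_mul_mod {M : Type*} [AddCommMonoid M] (f : ℕ → M) (x n : ℕ) :
    ∑ i ∈ range (x * n), f (i % n) = x • ∑ j ∈ range n, f j := by
  induction x with
  | zero => simp
  | succ x ih =>
    rw [add_mul, one_mul, sum_range_add, ih, succ_nsmul]
    congr 1
    refine sum_congr rfl fun i hi => ?_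
    rw [add_comm, Nat.add_mul_mod_self_right, Nat.mod_eq_of_lt (mem_range.1 hi)]

lemma visits_eq_sum_range (hk : 0 < k) (a : Fin k → V) :
    visits a = ∑ j ∈ range k, Pi.single (a ⟨j % k, Nat.mod_lt _ hk⟩) (1 : ℤ) := by
  rw [visits, ← Fin.sum_univ_eq_sum_range
    (fun j => (Pi.single (a ⟨j % k, Nat.mod_lt _ hk⟩) (1 : ℤ) : V → ℤ))]
  refine sum_congr rfl fun j _ => ?_
  congr 2; ext; exact (Nat.mod_eq_of_lt j.2).symm

/-- Wind `x ≥ 1` times around `a` and then `d - x` times around `b`, where `a` and `b` differ in at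
most one coordinate. -/
lemma IsWalk.replace (hk : 0 < k) (ha : univ.image a ∈ F) (hb : univ.image b ∈ F) (j₀ : Fin k)
    (hab : ∀ j ≠ j₀, a j = b j) {x y : ℕ} (hx : 1 ≤ x) (hxd : x + y = d) :
    IsWalk F d a b (x • visits a + y • visits b) := by
  have hlt : ∀ p, p % k < k := fun p => Nat.mod_lt _ hk
  have hd : k * d = x * k + y * k := by rw [← hxd]; ring
  have hxk : 1 * k ≤ x * k := Nat.mul_le_mul_right k hx
  refine ⟨k, fun p => if p < x * k then a ⟨p % k, hlt p⟩ else b ⟨p % k, hlt p⟩, ?_, ?_, ?_, ?_⟩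
  · intro j
    beta_reduce
    rw [if_pos (by omega)]; exact congrArg a (Fin.ext (Nat.mod_eq_of_lt j.2))
  · intro j
    beta_reduce
    rw [if_neg (by rw [hd]; omega)]; exact congrArg b (Fin.ext (by simp [Nat.mod_eq_of_lt j.2]))
  · intro i _
    obtain ⟨z, hz, hz'⟩ := exists_add_mod_eq (i * d) j₀.2
    have huniq : ∀ j : Fin k, (i * d + j) % k = j₀ → (j : ℕ) = z := by
      intro j hj
      have : i * d + j ≡ i * d + z [MOD k] := by rw [Nat.ModEq, hj, hz']
      have := Nat.ModEq.add_left_cancel' _ this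
      rwa [Nat.ModEq, Nat.mod_eq_of_lt j.2, Nat.mod_eq_of_lt hz] at this
    by_cases h : i * d + z < x * k
    · rw [← image_comp_add_mod hk (i * d)] at ha
      convert ha using 1
      refine image_congr fun j _ => ?_
      dsimp only
      split_ifs with hj
      · rfl
      · refine (hab _ fun he => hj ?_).symm
        rw [huniq j (congrArg Fin.val he)]; exact h
    · rw [← image_comp_add_mod hk (i * d)] at hb
      convert hb using 1
      refine image_congr fun j _ => ?_
      dsimp only
      split_ifs with hj
      · refine hab _ fun he => h ?_
        rw [← huniq j (congrArg Fin.val he)]; exact hj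
      · rfl
  · rw [hd, sum_range_add, visits_eq_sum_range hk, visits_eq_sum_range hk,
      ← sum_range_mul_mod (fun i => (Pi.single (a ⟨i % k, hlt i⟩) (1 : ℤ) : V → ℤ)),
      ← sum_range_mul_mod (fun i => (Pi.single (b ⟨i % k, hlt i⟩) (1 : ℤ) : V → ℤ))]
    congr 1
    · refine sum_congr rfl fun i hi => ?_
      beta_reduce
      rw [if_pos (mem_range.1 hi)]; simp
    · refine sum_congr rfl fun i hi => ?_
      beta_reduce
      rw [if_neg (by omega)]; simp

lemma IsWalk.stay (hk : 0 < k) (hd : 0 < d) (ha : univ.image a ∈ F) :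
    IsWalk F d a a (d • visits a) := by
  simpa using IsWalk.replace hk ha ha ⟨0, hk⟩ (fun _ _ => rfl) (x := d) (y := 0) hd rfl

/-- Moving one block forward along the periodic walk around `a`. -/
lemma IsWalk.exists_rotate (hk : 0 < k) (ha : univ.image a ∈ F) :
    ∃ (b : Fin k → V) (x : V → ℤ), univ.image b ∈ F ∧
      IsWalk F d a b x ∧ x = ∑ i ∈ range d, Pi.single (a ⟨i % k, Nat.mod_lt _ hk⟩) 1 := by
  refine ⟨fun j => a ⟨(d + j) % k, Nat.mod_lt _ hk⟩, _, ?_,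
    ⟨1, fun p => a ⟨p % k, Nat.mod_lt _ hk⟩, ?_, ?_, ?_, rfl⟩, by rw [one_mul]⟩
  · rwa [image_comp_add_mod hk]
  · intro j; exact congrArg a (Fin.ext (Nat.mod_eq_of_lt j.2))
  · intro j; simp
  · intro i _
    rwa [image_comp_add_mod hk]

lemma IsWalk.dvd_sum [Fintype V] {x : V → ℤ} (h : IsWalk F d a b x) : (d : ℤ) ∣ ∑ v, x v := by
  obtain ⟨N, w, -, -, -, rfl⟩ := h
  simp only [Finset.sum_apply]
  rw [sum_comm]
  simp

lemma IsWalk.eq_zero (hd : 0 < d) (hdk : d ≤ k) {x : V → ℤ} (h : IsWalk F d a b x) {v : V}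
    (hv : ∀ e ∈ F, v ∉ e) : x v = 0 := by
  obtain ⟨N, w, -, -, h3, rfl⟩ := h
  rw [Finset.sum_apply]
  refine sum_eq_zero fun i hi => Pi.single_eq_of_ne ?_ _
  rintro rfl
  have hm := Nat.mod_lt i hd
  refine hv _ (h3 (i / d) ?_) (mem_image.2 ⟨⟨i % d, by omega⟩, mem_univ _, ?_⟩)
  · exact Nat.div_le_of_le_mul (by rw [mul_comm]; exact (mem_range.1 hi).le)
  · simp [Nat.div_add_mod']

lemma sum_range_mul_div_mod {M : Type*} [AddCommMonoid M] (f : ℕ → ℕ → M) (N : ℕ) {n : ℕ}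
    (hn : 0 < n) :
    ∑ i ∈ range (N * n), f (i / n) (i % n) = ∑ b ∈ range N, ∑ o ∈ range n, f b o := by
  induction N with
  | zero => simp
  | succ N ih =>
    rw [add_mul, one_mul, sum_range_add, ih, sum_range_succ]
    congr 1
    refine sum_congr rfl fun i hi => ?_
    have := mem_range.1 hi
    rw [add_comm, Nat.add_mul_mod_self_right, Nat.mod_eq_of_lt this,
      Nat.add_mul_div_right _ _ hn, Nat.div_eq_of_lt this, zero_add]

/-- The number of visits to the `j`-th vertex in one period of the densest closed walk. -/
def weight (k d j : ℕ) : ℕ := if j % d < k % d then k / d else k / d + 1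

/-- The visits in one period of the densest closed walk around `a`. -/
def denseVisits (d : ℕ) (a : Fin k → V) : V → ℤ :=
  ∑ j : Fin k, weight k d j • Pi.single (a j) (1 : ℤ)

lemma sum_weight_nsmul {M : Type*} [AddCommMonoid M] (hd : 0 < d) (f : ℕ → M) :
    ∑ j ∈ range k, weight k d j • f j =
      ∑ p ∈ range (k / d * (k / d + 1) * d),
        f (if p % d < k % d then p / d % (k / d + 1) * d + p % d
          else p / d % (k / d) * d + p % d) := by
  set q := k / d
  set r := k % d
  have hr : r < d := Nat.mod_lt _ hd
  have hk : k = q * d + r := (Nat.div_add_mod' k d).symm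
  rw [sum_range_mul_div_mod (fun b o => f (if o < r then b % (q + 1) * d + o else b % q * d + o))
    _ hd, sum_comm]
  have h1 : ∑ j ∈ range (q * d), weight k d j • f j =
      ∑ b ∈ range q, ∑ o ∈ range d, (if o < r then q else q + 1) • f (b * d + o) := by
    rw [← sum_range_mul_div_mod (fun b o => (if o < r then q else q + 1) • f (b * d + o)) _ hd]
    refine sum_congr rfl fun j _ => ?_
    rw [Nat.div_add_mod', weight]
  have h2 : ∑ i ∈ range r, weight k d (q * d + i) • f (q * d + i) =
      ∑ o ∈ range d, if o < r then q • f (q * d + o) else 0 := by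
    rw [← sum_filter]
    have : (range d).filter (· < r) = range r := by
      ext i; simp; omega
    rw [this]
    refine sum_congr rfl fun i hi => ?_
    have hi := mem_range.1 hi
    rw [weight, add_comm, Nat.add_mul_mod_self_right, Nat.mod_eq_of_lt (by omega), if_pos hi]
  conv_lhs => rw [hk, sum_range_add, ← hk, h1, h2, sum_comm, ← sum_add_distrib]
  refine sum_congr rfl fun o _ => ?_
  split_ifs with ho
  · rw [sum_range_mul_mod (fun b => f (b * d + o)), sum_range_succ, nsmul_add, smul_sum]
  · rw [mul_comm q, sum_range_mul_mod (fun b => f (b * d + o)), smul_sum, add_zero]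

/-- The densest closed walk around an ordered edge. -/
lemma IsWalk.dense (hd : 0 < d) (hdk : d ≤ k) (ha : univ.image a ∈ F) :
    IsWalk F d a a (denseVisits d a) := by
  set q := k / d with hq
  set r := k % d with hr'
  have hr : r < d := Nat.mod_lt _ hd
  have hk : k = q * d + r := (Nat.div_add_mod' k d).symm
  have hq0 : 0 < q := Nat.div_pos hdk hd
  set idx : ℕ → ℕ := fun p => if p % d < r then p / d % (q + 1) * d + p % d
          else p / d % q * d + p % d with hidx
  have hlt : ∀ p, idx p < k := by
    intro p
    have hm := Nat.mod_lt p hd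
    simp only [hidx]
    split_ifs with h
    · have : p / d % (q + 1) ≤ q := Nat.lt_succ_iff.1 (Nat.mod_lt _ (by omega))
      have := Nat.mul_le_mul_right d this
      omega
    · have : p / d % q + 1 ≤ q := Nat.mod_lt _ hq0
      have := Nat.mul_le_mul_right d this
      rw [add_mul] at this
      omega
  have hstart : ∀ p < k, idx p = p := by
    intro p hp
    have hdm := Nat.div_add_mod' p d
    have hm := Nat.mod_lt p hd
    simp only [hidx]
    split_ifs with h
    · have : p / d < q + 1 := by
        rw [Nat.div_lt_iff_lt_mul hd, add_mul]; omega
      rw [Nat.mod_eq_of_lt this, hdm]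
    · have : p / d < q := by
        by_contra hc
        have := Nat.mul_le_mul_right d (not_lt.1 hc)
        omega
      rw [Nat.mod_eq_of_lt this, hdm]
  have hperiod : ∀ p, idx (q * (q + 1) * d + p) = idx p := by
    intro p
    have h1 : (q * (q + 1) * d + p) % d = p % d := by simp
    have h2 : (q * (q + 1) * d + p) / d = q * (q + 1) + p / d := by
      rw [add_comm, Nat.add_mul_div_right _ _ hd, add_comm]
    simp only [hidx, h1, h2, Nat.mul_add_mod, Nat.mul_add_mod_self_right]
  refine ⟨q * (q + 1), fun p => a ⟨idx p, hlt p⟩, ?_, ?_, ?_, ?_⟩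
  · intro j; exact congrArg a (Fin.ext (hstart _ j.2))
  · intro j; exact congrArg a (Fin.ext ((hperiod _).trans (hstart _ j.2)))
  · intro i _
    convert ha using 1
    ext v
    simp only [mem_image, mem_univ, true_and]
    constructor
    · rintro ⟨j, rfl⟩; exact ⟨_, rfl⟩
    · rintro ⟨j, rfl⟩
      have hdm := Nat.div_add_mod' (j : ℕ) d
      have hm := Nat.mod_lt (j : ℕ) hd
      have hj := j.2
      have hmod : ∀ y, (i * d + (y * d + j % d)) % d = j % d := by
        intro y; rw [← add_assoc, ← add_mul, add_comm, Nat.add_mul_mod_self_right, Nat.mod_mod]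
      have hdiv : ∀ y, (i * d + (y * d + j % d)) / d = i + y := by
        intro y
        rw [← add_assoc, ← add_mul, add_comm, Nat.add_mul_div_right _ _ hd, Nat.div_eq_of_lt hm,
          zero_add]
      by_cases h : (j : ℕ) % d < r
      · have : (j : ℕ) / d < q + 1 := by
          rw [Nat.div_lt_iff_lt_mul hd, add_mul]; omega
        obtain ⟨y, hy, hy'⟩ := exists_add_mod_eq i this
        have := Nat.mul_le_mul_right d (Nat.lt_succ_iff.1 hy)
        refine ⟨⟨y * d + j % d, by omega⟩, ?_⟩
        congr 1; ext
        simp only [hidx, hmod, hdiv, if_pos h, hy', hdm]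
      · have : (j : ℕ) / d < q := by
          by_contra hc
          have := Nat.mul_le_mul_right d (not_lt.1 hc)
          omega
        obtain ⟨y, hy, hy'⟩ := exists_add_mod_eq i this
        have := Nat.mul_le_mul_right d (Nat.succ_le_of_lt hy)
        rw [Nat.succ_mul] at this
        refine ⟨⟨y * d + j % d, by omega⟩, ?_⟩
        congr 1; ext
        simp only [hidx, hmod, hdiv, if_neg h, hy', hdm]
  · have hk0 : 0 < k := by omega
    have := sum_weight_nsmul (k := k) hd
      (fun p => (Pi.single (a ⟨p % k, Nat.mod_lt _ hk0⟩) (1 : ℤ) : V → ℤ))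
    rw [← Fin.sum_univ_eq_sum_range (fun j => weight k d j •
      (Pi.single (a ⟨j % k, Nat.mod_lt _ hk0⟩) (1 : ℤ) : V → ℤ))] at this
    convert this using 1
    · refine sum_congr rfl fun j _ => ?_
      rw [show (⟨j % k, Nat.mod_lt _ hk0⟩ : Fin k) = j from Fin.ext (Nat.mod_eq_of_lt j.2)]
    · refine sum_congr rfl fun p _ => ?_
      exact congrArg (fun v => (Pi.single (a v) (1 : ℤ) : V → ℤ))
        (Fin.ext (Nat.mod_eq_of_lt (hlt p)).symm)

end Walks

section Connectivity

variable {V : Type*} [DecidableEq V] {k : ℕ} {F : Finset (Finset V)} {d : ℕ}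

/-- Any two supported `(k - 1)`-sets have a common neighbour. -/
def CommonNeighbours (F : Finset (Finset V)) (k : ℕ) : Prop :=
  ∀ a b : Fin k → V, univ.image a ∈ F → univ.image b ∈ F → ∀ i j, ∃ w,
    univ.image (Function.update a i w) ∈ F ∧ univ.image (Function.update b j w) ∈ F

lemma exists_ordering (hF : ∀ e ∈ F, e.card = k) {e : Finset V} (he : e ∈ F) {v : V} (hv : v ∈ e)
    (j : Fin k) : ∃ a : Fin k → V, univ.image a = e ∧ a j = v := by
  let f : Fin k ≃ e := (e.equivFinOfCardEq (hF e he)).symm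
  refine ⟨fun i => (f (Equiv.swap j (f.symm ⟨v, hv⟩) i) : V), ?_, by simp⟩
  ext u
  simp only [mem_image, mem_univ, true_and]
  constructor
  · rintro ⟨i, rfl⟩; exact (f _).2
  · intro hu
    exact ⟨Equiv.swap j (f.symm ⟨v, hv⟩) (f.symm ⟨u, hu⟩), by simp⟩

lemma injective_of_image_mem (hF : ∀ e ∈ F, e.card = k) {a : Fin k → V} (ha : univ.image a ∈ F) :
    Function.Injective a := by
  have h : (univ.image a).card = (univ : Finset (Fin k)).card := by rw [hF _ ha, card_fin]
  simpa using card_image_iff.1 h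

lemma sum_visits [Fintype V] (a : Fin k → V) : ∑ v, visits a v = k := by
  simp only [visits, Finset.sum_apply]
  rw [sum_comm]
  simp

lemma visits_update (a : Fin k → V) (j : Fin k) (w : V) :
    visits (Function.update a j w) = visits a - Pi.single (a j) 1 + Pi.single w 1 := by
  rw [visits, visits, ← add_sum_erase _ _ (mem_univ j), ← add_sum_erase univ _ (mem_univ j)]
  have : ∀ i ∈ univ.erase j, (Pi.single (Function.update a j w i) (1 : ℤ) : V → ℤ) =
      Pi.single (a i) 1 := by
    intro i hi
    rw [Function.update_of_ne (ne_of_mem_erase hi)]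
  rw [sum_congr rfl this, Function.update_self]
  abel

lemma CommonNeighbours.exists_walk [Fintype V] (h : CommonNeighbours F k) (hk : 0 < k) (hd : 0 < d)
    {a b : Fin k → V} (ha : univ.image a ∈ F) (hb : univ.image b ∈ F) :
    ∃ x, IsWalk F d a b x ∧ ((k * d : ℕ) : ℤ) ∣ ∑ v, x v := by
  induction hn : (univ.filter fun j => a j ≠ b j).card using Nat.strong_induction_on
    generalizing a b with
  | _ n ih =>
    by_cases hab : a = b
    · subst hab
      exact ⟨0, IsWalk.refl hk ha, by simp⟩
    · obtain ⟨j, hj⟩ := Function.ne_iff.1 hab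
      obtain ⟨w, hwa, hwb⟩ := h a b ha hb j j
      have hlt : (univ.filter fun i =>
          Function.update a j w i ≠ Function.update b j w i).card < n := by
        rw [← hn]
        refine card_lt_card ⟨fun i hi => ?_, fun hs => ?_⟩
        · simp only [mem_filter, mem_univ, true_and] at hi ⊢
          rcases eq_or_ne i j with rfl | hij
          · simp at hi
          · simpa [Function.update_of_ne hij] using hi
        · simpa using hs (mem_filter.2 ⟨mem_univ j, hj⟩)
      obtain ⟨x, hx, hxd⟩ := ih _ hlt hwa hwb rfl
      have h1 := IsWalk.replace hk ha hwa j
        (fun i hi => (Function.update_of_ne hi w a).symm) (x := d) (y := 0) hd (add_zero d)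
      have h2 := IsWalk.replace hk hwb hb j
        (fun i hi => Function.update_of_ne hi w b) (x := d) (y := 0) hd (add_zero d)
      refine ⟨_, (h1.trans hx).trans h2, ?_⟩
      simp only [Pi.add_apply, Pi.smul_apply, zero_smul, add_zero,
        sum_add_distrib, ← smul_sum, sum_visits]
      refine dvd_add (dvd_add ?_ hxd) ?_ <;> simp [mul_comm]

/-- The group generated by the visit vectors of closed walks at `a`. -/
def closedWalkGroup (F : Finset (Finset V)) (d : ℕ) (a : Fin k → V) (hk : 0 < k)
    (ha : univ.image a ∈ F) : AddSubgroup (V → ℤ) where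
  carrier := {z | ∃ p p', IsWalk F d a a p ∧ IsWalk F d a a p' ∧ z = p - p'}
  zero_mem' := ⟨0, 0, IsWalk.refl hk ha, IsWalk.refl hk ha, by simp⟩
  add_mem' := by
    rintro _ _ ⟨p, p', h, h', rfl⟩ ⟨q, q', g, g', rfl⟩
    exact ⟨p + q, p' + q', h.trans g, h'.trans g', by abel⟩
  neg_mem' := by
    rintro _ ⟨p, p', h, h', rfl⟩
    exact ⟨p', p, h', h, by abel⟩

section

variable {a₀ : Fin k → V} (hk : 0 < k) (h₀ : univ.image a₀ ∈ F)

lemma IsWalk.mem_group {x : V → ℤ} (h : IsWalk F d a₀ a₀ x) :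
    x ∈ closedWalkGroup F d a₀ hk h₀ :=
  ⟨x, 0, h, IsWalk.refl hk h₀, by simp⟩

variable [Fintype V]

lemma CommonNeighbours.sub_mem_group (h : CommonNeighbours F k) (hd : 0 < d) {a : Fin k → V}
    (ha : univ.image a ∈ F) {x y : V → ℤ} (hx : IsWalk F d a a x) (hy : IsWalk F d a a y) :
    x - y ∈ closedWalkGroup F d a₀ hk h₀ := by
  obtain ⟨p, hp, -⟩ := h.exists_walk hk hd h₀ ha
  obtain ⟨q, hq, -⟩ := h.exists_walk hk hd ha h₀
  exact ⟨_, _, (hp.trans hx).trans hq, (hp.trans hy).trans hq, by abel⟩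

lemma CommonNeighbours.single_sub_mem_group_of_update (h : CommonNeighbours F k) (hd : 0 < d)
    {a : Fin k → V} (ha : univ.image a ∈ F) {j : Fin k} {w : V}
    (hw : univ.image (Function.update a j w) ∈ F) :
    Pi.single w 1 - Pi.single (a j) 1 ∈ closedWalkGroup F d a₀ hk h₀ := by
  have h1 := IsWalk.replace hk ha hw j
    (fun i hi => (Function.update_of_ne hi w a).symm) (x := d) (y := 0) hd (add_zero d)
  have h2 := IsWalk.replace (d := d) hk hw ha j
    (fun i hi => Function.update_of_ne hi w a) (x := 1) (y := d - 1) le_rfl (by omega)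
  have h3 := IsWalk.stay hk hd ha
  have := h.sub_mem_group hk h₀ hd ha (h1.trans h2) (h3.trans h3)
  convert this using 1
  obtain ⟨n, rfl⟩ : ∃ n, d = n + 1 := ⟨d - 1, by omega⟩
  rw [visits_update, Nat.add_sub_cancel, succ_nsmul]
  simp only [zero_smul, one_smul]
  abel

lemma CommonNeighbours.single_sub_mem_group (h : CommonNeighbours F k) (hd : 0 < d)
    (hF : ∀ e ∈ F, e.card = k) {u v : V} (hu : ∃ e ∈ F, u ∈ e) (hv : ∃ e ∈ F, v ∈ e) :
    Pi.single u 1 - Pi.single v 1 ∈ closedWalkGroup F d a₀ hk h₀ := by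
  obtain ⟨e, he, hue⟩ := hu
  obtain ⟨f, hf, hvf⟩ := hv
  obtain ⟨a, rfl, rfl⟩ := exists_ordering hF he hue ⟨0, hk⟩
  obtain ⟨b, rfl, rfl⟩ := exists_ordering hF hf hvf ⟨0, hk⟩
  obtain ⟨w, hwa, hwb⟩ := h a b he hf ⟨0, hk⟩ ⟨0, hk⟩
  have h1 := h.single_sub_mem_group_of_update hk h₀ hd he hwa
  have h2 := h.single_sub_mem_group_of_update hk h₀ hd hf hwb
  simpa using sub_mem h2 h1

lemma eq_sum_single_sub_add (z : V → ℤ) (u : V) :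
    z = ∑ v, z v • (Pi.single v 1 - Pi.single u 1 : V → ℤ) + (∑ v, z v) • Pi.single u 1 := by
  have : z = ∑ v, z v • (Pi.single v 1 : V → ℤ) := by
    ext w
    simp [Finset.sum_apply, Pi.single_apply]
  conv_lhs => rw [this]
  simp only [smul_sub, sum_sub_distrib, ← sum_smul, sub_add_cancel]

lemma CommonNeighbours.mem_group (h : CommonNeighbours F k) (hd : 0 < d) (hdk : d ≤ k)
    (hF : ∀ e ∈ F, e.card = k) {z : V → ℤ} (hz : ∀ v, (∀ e ∈ F, v ∉ e) → z v = 0)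
    (hzd : (d : ℤ) ∣ ∑ v, z v) : z ∈ closedWalkGroup F d a₀ hk h₀ := by
  set H := closedWalkGroup F d a₀ hk h₀
  set u := a₀ ⟨0, hk⟩
  have hu : ∃ e ∈ F, u ∈ e := ⟨_, h₀, mem_image_of_mem _ (mem_univ _)⟩
  have key : ∀ y : V → ℤ, (∀ v, (∀ e ∈ F, v ∉ e) → y v = 0) →
      ∑ v, y v • (Pi.single v 1 - Pi.single u 1 : V → ℤ) ∈ H := by
    intro y hy
    refine sum_mem fun v _ => ?_
    by_cases hv : ∃ e ∈ F, v ∈ e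
    · exact zsmul_mem (h.single_sub_mem_group hk h₀ hd hF hv hu) _
    · push Not at hv
      rw [hy v hv, zero_smul]
      exact zero_mem _
  have hdu : (d : ℤ) • (Pi.single u 1 : V → ℤ) ∈ H := by
    obtain ⟨b, x, hb, hx, hxe⟩ := IsWalk.exists_rotate (d := d) hk h₀
    obtain ⟨y, hy, M, hM⟩ := h.exists_walk hk hd hb h₀
    have hxs : ∑ v, x v = d := by
      rw [hxe]
      simp only [Finset.sum_apply]
      rw [sum_comm]
      simp
    have hst := IsWalk.stay hk hd h₀
    have hmem : x + y - M • (d • visits a₀) ∈ H :=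
      sub_mem ((hx.trans hy).mem_group hk h₀) (zsmul_mem (hst.mem_group hk h₀) _)
    rw [eq_sum_single_sub_add (x + y - M • (d • visits a₀)) u] at hmem
    have hsum : ∑ v, (x + y - M • (d • visits a₀)) v = d := by
      simp only [Pi.sub_apply, Pi.add_apply, Pi.smul_apply, sum_sub_distrib, sum_add_distrib,
        ← smul_sum, sum_visits, hxs, hM]
      simp
      ring
    rw [hsum] at hmem
    refine (add_mem_cancel_left (key _ fun v hv => ?_)).1 hmem
    have e1 := (hx.trans hy).eq_zero hd hdk hv
    have e2 := hst.eq_zero hd hdk hv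
    rw [Pi.sub_apply, e1, Pi.smul_apply, e2]; simp
  rw [eq_sum_single_sub_add z u]
  refine add_mem (key z hz) ?_
  obtain ⟨M, hM⟩ := hzd
  rw [hM, mul_comm, mul_smul]
  exact zsmul_mem hdu _

end

end Connectivity

section Cone

variable {V : Type*} [Fintype V]

lemma exists_nonneg_combination {ι : Type*} [Fintype ι] (g : ι → V → ℝ) {D : ℝ}
    (hD : 0 < D)
    (hg : ∀ i, ∑ v, g i v = D) (c : V → ℝ) (hc : 0 < ∑ v, c v)
    (h : ∀ y : V → ℝ, (∀ i, 0 ≤ ∑ v, g i v * y v) → 0 ≤ ∑ v, c v * y v) :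
    ∃ l : ι → ℝ, (∀ i, 0 ≤ l i) ∧ c = ∑ i, l i • g i := by
  classical
  set σ := ∑ v, c v
  have hmem : (D / σ) • c ∈ convexHull ℝ (Set.range g) := by
    by_contra hcon
    obtain ⟨f, u, hfu, hu⟩ := geometric_hahn_banach_point_closed (convex_convexHull ℝ _)
      ((Set.finite_range g).isClosed_convexHull ℝ) hcon
    have hf : ∀ x : V → ℝ, ∑ v, x v * (f (Pi.single v 1) - u / D) = f x - (∑ v, x v) * (u / D) := by
      intro x
      have hx : f x = ∑ v, x v * f (Pi.single v 1) := by
        have : x = ∑ v, x v • (Pi.single v 1 : V → ℝ) := by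
          ext w
          simp [Finset.sum_apply, Pi.single_apply]
        conv_lhs => rw [this]
        simp only [map_sum, map_smul, smul_eq_mul]
      rw [hx]
      simp only [mul_sub, sum_sub_distrib, sum_mul]
    have h1 := h (fun v => f (Pi.single v 1) - u / D) fun i => by
      rw [hf, hg, mul_div_cancel₀ _ hD.ne']
      exact sub_nonneg.2 (hu _ (subset_convexHull ℝ _ ⟨i, rfl⟩)).le
    rw [hf, map_smul, smul_eq_mul] at *
    have h2 : D / σ * (f c - σ * (u / D)) = D / σ * f c - u := by field_simp
    have h3 : 0 < D / σ := by positivity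
    nlinarith [mul_nonneg h3.le h1]
  rw [convexHull_range_eq_exists_affineCombination] at hmem
  obtain ⟨t, w, hw0, hw1, hw⟩ := hmem
  rw [affineCombination_eq_linear_combination _ _ _ hw1] at hw
  refine ⟨fun i => if i ∈ t then σ / D * w i else 0, fun i => ?_, ?_⟩
  · dsimp only
    split_ifs with hi
    · have := hw0 i hi
      positivity
    · exact le_rfl
  · simp only [ite_smul, zero_smul, sum_ite_mem, univ_inter, mul_smul]
    rw [← smul_sum, hw, smul_smul]
    have : σ / D * (D / σ) = 1 := by field_simp
    rw [this, one_smul]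


end Cone

section Absorption

variable {V : Type*} [DecidableEq V] {k : ℕ} {F : Finset (Finset V)} {d : ℕ}

/-- The visit vectors of closed walks at `a`. -/
def closedWalks (F : Finset (Finset V)) (d : ℕ) (a : Fin k → V) (hk : 0 < k)
    (ha : univ.image a ∈ F) : AddSubmonoid (V → ℤ) where
  carrier := {x | IsWalk F d a a x}
  zero_mem' := IsWalk.refl hk ha
  add_mem' := fun h h' => h.trans h'

lemma denseVisits_nonneg (a : Fin k → V) : 0 ≤ denseVisits d a := by
  refine sum_nonneg fun j _ => nsmul_nonneg ?_ _
  exact Pi.single_nonneg.2 zero_le_one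

lemma sum_denseVisits_mul [Fintype V] (a : Fin k → V) (y : V → ℝ) :
    ∑ v, (denseVisits d a v : ℝ) * y v = ∑ j : Fin k, (weight k d j : ℝ) * y (a j) := by
  simp only [denseVisits, Finset.sum_apply, Pi.smul_apply, Int.cast_sum, sum_mul]
  rw [sum_comm]
  refine sum_congr rfl fun j _ => ?_
  simp [Pi.single_apply, ite_mul]

lemma sum_weight (hd : 0 < d) :
    ∑ j : Fin k, weight k d j = k / d * (k / d + 1) * d := by
  have := sum_weight_nsmul (k := k) hd (fun _ => (1 : ℕ))
  simp only [smul_eq_mul, mul_one, sum_const, card_range] at this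
  rw [← this, Fin.sum_univ_eq_sum_range (fun j => weight k d j)]

lemma CommonNeighbours.eventually_isWalk [Fintype V] (h : CommonNeighbours F k) (hk : 0 < k) (hd : 0 < d)
    (hdk : d ≤ k) (hF : ∀ e ∈ F, e.card = k) {a₀ : Fin k → V} (h₀ : univ.image a₀ ∈ F) {γ : ℝ}
    (hγ : 0 < γ) (hγ1 : 3 * γ < 1)
    (hdual : ∀ c : V → ℝ, (∀ v, (∃ e ∈ F, v ∈ e) → |c v - 1| ≤ 3 * γ) →
      (∀ v, (∀ e ∈ F, v ∉ e) → c v = 0) → ∀ y : V → ℝ,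
      (∀ a : Fin k → V, univ.image a ∈ F → 0 ≤ ∑ j : Fin k, (weight k d j : ℝ) * y (a j)) →
      0 ≤ ∑ v, c v * y v) :
    ∀ᶠ m : ℕ in Filter.atTop, ∀ z : V → ℤ,
      (∀ v, (∃ e ∈ F, v ∈ e) → |(z v : ℝ) - m| ≤ 2 * γ * m) →
      (∀ v, (∀ e ∈ F, v ∉ e) → z v = 0) → (d : ℤ) ∣ ∑ v, z v → IsWalk F d a₀ a₀ z := by
  classical
  let OE := {a : Fin k → V // univ.image a ∈ F}
  set Λ := closedWalks F d a₀ hk h₀ with hΛ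
  set H := closedWalkGroup F d a₀ hk h₀
  have hp : ∀ a : OE, ∃ p, ∀ n : ℕ, p + n • denseVisits d a.1 ∈ Λ := by
    rintro ⟨a, ha⟩
    obtain ⟨p, hp, -⟩ := h.exists_walk hk hd h₀ ha
    obtain ⟨q, hq, -⟩ := h.exists_walk hk hd ha h₀
    refine ⟨p + q, fun n => ?_⟩
    have hn : n • denseVisits d a ∈ closedWalks F d a hk ha :=
      nsmul_mem (show denseVisits d a ∈ closedWalks F d a hk ha from IsWalk.dense hd hdk ha) n
    have := (hp.trans hn).trans hq
    rwa [add_right_comm] at this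
  choose p hp using hp
  set G : V → ℤ := ∑ a : OE, denseVisits d a.1
  have hQ : ∀ x : V → ℤ, ∃ p', p' ∈ Λ ∧ (x ∈ H → p' + x ∈ Λ) := by
    intro x
    by_cases hx : x ∈ H
    · obtain ⟨q, q', hq, hq', rfl⟩ := hx
      exact ⟨q', hq', fun _ => by rw [add_sub_cancel]; exact hq⟩
    · exact ⟨0, zero_mem _, fun h => absurd h hx⟩
  choose p' hp' hp'' using hQ
  set Q : V → ℤ := ∑ x ∈ Icc 0 G, p' x
  have hQx : ∀ x ∈ H, x ∈ Icc 0 G → Q + x ∈ Λ := by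
    intro x hx hxG
    have : Q + x = (p' x + x) + ∑ x' ∈ (Icc 0 G).erase x, p' x' := by
      simp only [Q]; rw [← add_sum_erase _ _ hxG]; abel
    rw [this]
    exact add_mem (hp'' x hx) (sum_mem fun x' _ => hp' x')
  set R : V → ℤ := ∑ a, p a + Q with hR
  have hRΛ : R ∈ Λ := add_mem (sum_mem fun a _ => by simpa using hp a 0) (sum_mem fun x _ => hp' x)
  have hlarge : ∀ᶠ m : ℕ in Filter.atTop, ∀ v, |(R v : ℝ)| ≤ γ * m :=
    Filter.eventually_all.2 fun v =>
      (Filter.Tendsto.const_mul_atTop hγ tendsto_natCast_atTop_atTop).eventually_ge_atTop _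
  filter_upwards [hlarge, Filter.eventually_gt_atTop 0] with m hm hm0 z hz hz0 hzd
  have hm0' : (0 : ℝ) < m := by exact_mod_cast hm0
  have hR0 : ∀ v, (∀ e ∈ F, v ∉ e) → R v = 0 := fun v hv => IsWalk.eq_zero hd hdk hRΛ hv
  set c : V → ℝ := fun v => ((z v : ℝ) - R v) / m with hc
  have hc1 : ∀ v, (∃ e ∈ F, v ∈ e) → |c v - 1| ≤ 3 * γ := by
    intro v hv
    have : c v - 1 = ((z v - m) - R v) / m := by
      simp only [hc]; field_simp; ring
    rw [this, abs_div, abs_of_pos hm0', div_le_iff₀ hm0']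
    calc _ ≤ |(z v : ℝ) - m| + |(R v : ℝ)| := abs_sub _ _
      _ ≤ _ := by linarith [hz v hv, hm v]
  have hc0 : ∀ v, (∀ e ∈ F, v ∉ e) → c v = 0 := by
    intro v hv
    simp [hc, hz0 v hv, hR0 v hv]
  have hcnn : ∀ v, 0 ≤ c v := by
    intro v
    by_cases hv : ∃ e ∈ F, v ∈ e
    · have := (abs_le.1 (hc1 v hv)).1
      linarith
    · push Not at hv
      rw [hc0 v hv]
  have hcpos : 0 < ∑ v, c v := by
    have hv : ∃ e ∈ F, a₀ ⟨0, hk⟩ ∈ e := ⟨_, h₀, mem_image_of_mem _ (mem_univ _)⟩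
    have := (abs_le.1 (hc1 _ hv)).1
    exact sum_pos' (fun v _ => hcnn v) ⟨_, mem_univ _, by linarith⟩
  have hD : 0 < ((k / d * (k / d + 1) * d : ℕ) : ℝ) := by
    have := Nat.div_pos hdk hd
    positivity
  obtain ⟨l, hl, hcl⟩ := exists_nonneg_combination
    (fun (a : OE) v => (denseVisits d a.1 v : ℝ)) hD
    (fun a => by
      have := sum_denseVisits_mul (d := d) a.1 (fun _ => 1)
      simp only [mul_one] at this
      rw [this, ← sum_weight hd]; push_cast; rfl) c hcpos
    (fun y hy => hdual c hc1 hc0 y fun a ha => by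
      rw [← sum_denseVisits_mul]; exact hy ⟨a, ha⟩)
  set N : OE → ℕ := fun a => ⌊m * l a⌋₊ with hN
  set x : V → ℤ := z - R - ∑ a, N a • denseVisits d a.1 with hx
  have hxv : ∀ v, (x v : ℝ) = ∑ a : OE, (m * l a - N a) * (denseVisits d a.1 v : ℝ) := by
    intro v
    have h1 : (z v : ℝ) - R v = m * c v := by simp only [hc]; field_simp
    have h2 : c v = ∑ a : OE, l a * (denseVisits d a.1 v : ℝ) := by
      conv_lhs => rw [hcl]
      simp [Finset.sum_apply]
    simp only [hx, Pi.sub_apply, Finset.sum_apply, Pi.smul_apply, Int.cast_sub, Int.cast_sum,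
      sub_mul, sum_sub_distrib, h1, h2, mul_sum]
    simp [mul_assoc]
  have hfrac : ∀ a, 0 ≤ m * l a - N a ∧ m * l a - N a ≤ 1 := by
    intro a
    have h0 : 0 ≤ m * l a := mul_nonneg hm0'.le (hl a)
    have h1 := Nat.floor_le h0
    have h2 := Nat.lt_floor_add_one (m * l a)
    exact ⟨by simpa [hN] using h1, by simp only [hN]; linarith⟩
  have hxI : x ∈ Icc 0 G := by
    refine mem_Icc.2 ⟨fun v => ?_, fun v => ?_⟩
    · have : (0 : ℝ) ≤ x v := by
        rw [hxv]
        refine sum_nonneg fun a _ => mul_nonneg (hfrac a).1 ?_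
        exact_mod_cast denseVisits_nonneg a.1 v
      exact_mod_cast this
    · have : (x v : ℝ) ≤ G v := by
        rw [hxv]
        simp only [G, Finset.sum_apply, Int.cast_sum]
        refine sum_le_sum fun a _ => mul_le_of_le_one_left ?_ (hfrac a).2
        exact_mod_cast denseVisits_nonneg a.1 v
      exact_mod_cast this
  have hzH : z ∈ H := h.mem_group hk h₀ hd hdk hF hz0 hzd
  have hdense : ∀ a : OE, denseVisits d a.1 ∈ H := fun a => by
    simpa using h.sub_mem_group hk h₀ hd a.2 (IsWalk.dense hd hdk a.2) (IsWalk.refl hk a.2)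
  have hxH : x ∈ H := sub_mem (sub_mem hzH (IsWalk.mem_group hk h₀ hRΛ))
    (sum_mem fun a _ => nsmul_mem (hdense a) _)
  have hz_eq : z = (∑ a, (p a + N a • denseVisits d a.1)) + (Q + x) := by
    rw [hx, hR, sum_add_distrib]; abel
  change z ∈ Λ
  rw [hz_eq]
  exact add_mem (sum_mem fun a _ => hp a _) (hQx x hxH hxI)

end Absorption

section Duality

variable {V : Type*} {k : ℕ}

lemma sum_comp_update (y : V → ℝ) (a : Fin k → V) (j : Fin k) (w : V) :
    ∑ i, y (Function.update a j w i) = ∑ i, y (a i) + (y w - y (a j)) := by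
  rw [← add_sum_erase _ _ (mem_univ j), ← add_sum_erase univ (fun i => y (a i)) (mem_univ j)]
  have : ∀ i ∈ univ.erase j, y (Function.update a j w i) = y (a i) := by
    intro i hi
    rw [Function.update_of_ne (ne_of_mem_erase hi)]
  rw [sum_congr rfl this, Function.update_self]
  ring

variable [DecidableEq V] {F : Finset (Finset V)} {d : ℕ}

lemma exists_minimal_ordering [Fintype V] (y : V → ℝ) (J : Finset (Fin k)) {a : Fin k → V}
    (ha : univ.image a ∈ F) :
    ∃ b : Fin k → V, univ.image b ∈ F ∧ (∀ j ∈ J, b j = a j) ∧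
      ∀ j ∉ J, ∀ w, univ.image (Function.update b j w) ∈ F → y (b j) ≤ y w := by
  obtain ⟨b, hb, hmin⟩ := exists_min_image
    (univ.filter fun b : Fin k → V => univ.image b ∈ F ∧ ∀ j ∈ J, b j = a j)
    (fun b => ∑ i, y (b i)) ⟨a, by simpa using ha⟩
  simp only [mem_filter, mem_univ, true_and] at hb hmin
  refine ⟨b, hb.1, hb.2, fun j hj w hw => ?_⟩
  have := hmin _ ⟨hw, fun i hi => ?_⟩
  · rw [sum_comp_update] at this
    linarith
  · rw [Function.update_of_ne (by rintro rfl; exact hj hi), hb.2 i hi]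

lemma weight_mod (k : ℕ) (d : ℕ) : weight k d (k % d) = k / d + 1 := by
  simp [weight]

lemma div_le_weight (k d j : ℕ) : k / d ≤ weight k d j := by
  rw [weight]; split_ifs <;> omega

variable [Fintype V]

lemma extremal_bounds {L ε g s b α β S : ℝ} (hL0 : 0 < L) (hL3 : L ≤ 1 / 3) (hε : 0 < ε)
    (hε1 : ε ≤ 1 / 2400) (hg0 : 0 ≤ g) (hg : g ≤ ε) (hspos : 0 < s) (hα0 : 0 ≤ α) (hβ0 : 0 ≤ β)
    (hbG : (1 - L - ε) * s ≤ β) (hlow : s - ε * s ≤ α + β) (hup : α + β ≤ s)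
    (hbpos : 0 < b) (hbL : L ≤ b * (1 - L)) (hS : 0 ≤ S)
    (hlt : S < (1 + g) * α - b * ((1 - g) * β)) :
    S < 4 * ε * s ∧ b * (1 - L) ≤ L + 4 * ε ∧ b ≤ 1 ∧ (L - 2 * ε) * s ≤ α := by
  have hαle : α ≤ (L + ε) * s := by linarith
  have hstar : b * ((1 - g) * (1 - L - ε)) * s ≤ b * ((1 - g) * β) := by
    have h1 : (1 - g) * ((1 - L - ε) * s) ≤ (1 - g) * β :=
      mul_le_mul_of_nonneg_left hbG (by linarith)
    linarith [mul_le_mul_of_nonneg_left h1 hbpos.le]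
  have hgL : g * L ≤ ε * (1 / 3) := mul_le_mul hg hL3 hL0.le hε.le
  have hgL0 : 0 ≤ g * L := mul_nonneg hg0 hL0.le
  have hge : g * ε ≤ ε * (1 / 2400) := mul_le_mul hg hε1 hε.le hε.le
  have hge0 : 0 ≤ g * ε := mul_nonneg hg0 hε.le
  have hαup : (1 + g) * α ≤ (L + 2 * ε) * s := by
    have h1 : (1 + g) * α ≤ (1 + g) * ((L + ε) * s) := mul_le_mul_of_nonneg_left hαle (by linarith)
    have h2 : (1 + g) * (L + ε) ≤ L + 2 * ε := by linarith
    linarith [mul_le_mul_of_nonneg_right h2 hspos.le]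
  have hb1 : b ≤ 1 := by
    by_contra! hb1
    have h2 : (1 / 2 : ℝ) ≤ (1 - g) * (1 - L - ε) := by linarith
    have h3 : b * (1 / 2) * s ≤ b * ((1 - g) * (1 - L - ε)) * s := by gcongr
    have h4 : (L + 2 * ε) * s ≤ 1 / 2 * s := by gcongr; linarith
    have h5 : 1 / 2 * s < b * (1 / 2) * s := by gcongr; linarith
    linarith
  have hbs : b * (1 - L) - 2 * ε ≤ b * ((1 - g) * (1 - L - ε)) := by
    have h1 : 1 - L - 2 * ε ≤ (1 - g) * (1 - L - ε) := by linarith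
    nlinarith [mul_le_mul_of_nonneg_left h1 hbpos.le]
  have hbs' := mul_le_mul_of_nonneg_right hbs hspos.le
  have hbup : b * (1 - L) ≤ L + 4 * ε := by
    have : (b * (1 - L) - 2 * ε) * s ≤ (L + 2 * ε) * s := by linarith
    linarith [le_of_mul_le_mul_right this hspos]
  have hcf : S < 4 * ε * s := by
    have := mul_le_mul_of_nonneg_right hbL hspos.le
    linarith
  have hαlow : (L - 2 * ε) * s ≤ α := by
    have h1 : b * ((1 - g) * β) ≤ (1 + g) * α := by linarith
    have h2 : L * ((1 - g) * β) ≤ (1 - L) * ((1 + g) * α) := by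
      have := mul_le_mul_of_nonneg_right hbL (mul_nonneg (by linarith : 0 ≤ 1 - g) hβ0)
      nlinarith [mul_le_mul_of_nonneg_left h1 (by linarith : 0 ≤ 1 - L)]
    have h3 : s - ε * s - α ≤ β := by linarith
    have h4 : α ≤ s := by linarith
    have h5 : β ≤ s := by linarith
    have h6 : g * β ≤ ε * s := mul_le_mul hg h5 hβ0 hε.le
    have h7 : g * α ≤ ε * s := mul_le_mul hg h4 hα0 hε.le
    have h8 : L * (g * β) ≤ 1 / 3 * (ε * s) := mul_le_mul hL3 h6 (by positivity) (by norm_num)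
    have h9 : (1 - L) * (g * α) ≤ 1 * (ε * s) :=
      mul_le_mul (by linarith) h7 (by positivity) (by norm_num)
    have h10 := mul_le_mul_of_nonneg_left h3 hL0.le
    have h11 : L * (ε * s) ≤ 1 / 3 * (ε * s) := by gcongr
    linarith
  exact ⟨hcf, hbup, hb1, hαlow⟩

lemma sum_mul_nonneg_of_normalized (hk : 2 ≤ k) (hd : 0 < d) (hdk : d < k)
    (hF : ∀ e ∈ F, e.card = k)
    {U : Finset V} (hU : ∀ v, v ∈ U ↔ ∃ e ∈ F, v ∈ e)
    {s t ε δ g : ℝ} (hs : s = Fintype.card V) (hUs : s - 1 ≤ U.card)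
    (ht : t = ((k / d * d : ℕ) : ℝ)) (ht3 : 3 ≤ t) (hε : 0 < ε) (hεδ : 100 * ε ≤ δ)
    (hδ : (k / d + 1 : ℕ) * t * δ ≤ 1 / 4) (hg0 : 0 ≤ g) (hg : g ≤ ε) (hεs : 1 ≤ ε * s)
    (hdeg : ∀ a : Fin k → V, univ.image a ∈ F → ∀ j, (1 - 1 / t - ε) * s ≤
      (univ.filter fun w => univ.image (Function.update a j w) ∈ F).card)
    (hpair : ∀ A ⊆ U, (1 / t - 10 * ε / δ) * s ≤ A.card →
      ∃ u ∈ A, ∃ v ∈ A, u ≠ v ∧ ∃ e ∈ F, u ∈ e ∧ v ∈ e)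
    {c : V → ℝ} (hc : ∀ v ∈ U, |c v - 1| ≤ g) (hc0 : ∀ v ∉ U, c v = 0) {y : V → ℝ}
    (hy : ∀ a : Fin k → V, univ.image a ∈ F → 0 ≤ ∑ j : Fin k, (weight k d j : ℝ) * y (a j))
    (hmin : ∀ v ∈ U, -1 ≤ y v) {v₁ : V} (hv₁ : v₁ ∈ U) (hyv₁ : y v₁ = -1) :
    0 ≤ ∑ v, c v * y v := by
  set q : ℝ := ((k / d : ℕ) : ℝ) with hq
  have hq1 : 1 ≤ q := by
    have := Nat.div_pos hdk.le hd
    rw [hq]; exact_mod_cast this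
  have hδ0 : 0 < δ := by linarith
  have hq' : ((k / d + 1 : ℕ) : ℝ) = q + 1 := by rw [hq]; push_cast; rfl
  rw [hq'] at hδ
  have hδ1 : δ ≤ 1 / 24 := by
    have h1 : (2 : ℝ) * 3 ≤ (q + 1) * t := mul_le_mul (by linarith) ht3 (by norm_num) (by linarith)
    have h2 := mul_le_mul_of_nonneg_right h1 hδ0.le
    linarith
  have hspos : 0 < s := by
    by_contra h
    linarith [mul_nonpos_of_nonneg_of_nonpos hε.le (not_lt.1 h)]
  set L := 1 / t with hL
  have hL3 : L ≤ 1 / 3 := one_div_le_one_div_of_le (by norm_num) ht3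
  have hL0 : 0 < L := by positivity
  have hLt : t * L = 1 := by rw [hL]; field_simp
  set W : Fin k → ℝ := fun j => (weight k d j : ℝ) with hW
  have hWq : ∀ j, q ≤ W j := fun j => by
    exact Nat.cast_le.2 (div_le_weight k d j)
  set jr : Fin k := ⟨k % d, (Nat.mod_lt _ hd).trans hdk⟩ with hjr
  have hWr : W jr = q + 1 := by
    rw [← hq']; exact congrArg Nat.cast (weight_mod k d)
  have hWsum : ∑ j, W j = (q + 1) * t := by
    simp only [hW]
    rw [← Nat.cast_sum, sum_weight hd, ht, ← hq']
    push_cast; ring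
  have hin : ∀ a : Fin k → V, univ.image a ∈ F → ∀ j, a j ∈ U := fun a ha j =>
    (hU _).2 ⟨_, ha, mem_image_of_mem _ (mem_univ _)⟩
  have hnbr : ∀ (a : Fin k → V) (j : Fin k),
      (univ.filter fun w => univ.image (Function.update a j w) ∈ F) ⊆ U := by
    intro a j w hw
    have := hin _ (mem_filter.1 hw).2 j
    rwa [Function.update_self] at this
  obtain ⟨b, hb, hbG⟩ : ∃ b, 1 ≤ (t - 1) * b ∧
      (1 - L - ε) * s ≤ (U.filter fun v => b ≤ y v).card := by
    obtain ⟨e, he, hve⟩ := (hU _).1 hv₁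
    obtain ⟨a', rfl, ha'⟩ := exists_ordering hF he hve jr
    obtain ⟨a, ha, hav, hamin⟩ := exists_minimal_ordering y {jr} he
    have har : y (a jr) = -1 := by rw [hav _ (mem_singleton_self _), ha', hyv₁]
    have hne : (univ.erase jr).Nonempty := by
      rw [← card_pos, card_erase_of_mem (mem_univ _), card_fin]; omega
    obtain ⟨j, hj, hjmax⟩ := exists_max_image (univ.erase jr) (fun j => y (a j)) hne
    refine ⟨y (a j), ?_, (hdeg a ha j).trans ?_⟩
    · have h1 := hy a ha
      rw [← add_sum_erase _ _ (mem_univ jr)] at h1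
      have h2 : ∑ i ∈ univ.erase jr, W i * y (a i) ≤ ∑ i ∈ univ.erase jr, W i * y (a j) :=
        sum_le_sum fun i hi => mul_le_mul_of_nonneg_left (hjmax i hi) (by linarith [hWq i])
      rw [← sum_mul] at h2
      have h3 := add_sum_erase univ W (mem_univ jr)
      rw [hWsum, hWr] at h3
      change 0 ≤ W jr * y (a jr) + ∑ i ∈ univ.erase jr, W i * y (a i) at h1
      rw [hWr, har] at h1
      have h4 : ∑ i ∈ univ.erase jr, W i = (q + 1) * (t - 1) := by linarith
      rw [h4] at h2
      have : 0 ≤ (q + 1) * ((t - 1) * y (a j) - 1) := by linarith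
      have := nonneg_of_mul_nonneg_right this (by linarith)
      linarith
    · refine Nat.cast_le.2 (card_le_card fun w hw => mem_filter.2 ⟨hnbr a j hw, ?_⟩)
      exact hamin j (by simpa using ne_of_mem_erase hj) w (mem_filter.1 hw).2
  by_contra! hneg
  have hbpos : 0 < b := by
    by_contra h
    linarith [mul_nonpos_of_nonneg_of_nonpos (by linarith : 0 ≤ t - 1) (not_lt.1 h)]
  have hbL : L ≤ b * (1 - L) := by
    have : 0 ≤ L * ((t - 1) * b - 1) := mul_nonneg hL0.le (by linarith)
    have h : L * ((t - 1) * b - 1) = t * L * b - L * b - L := by ring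
    rw [h, hLt] at this
    linarith
  set G := U.filter fun v => b ≤ y v with hG
  set G' := U.filter fun v => ¬ b ≤ y v with hG'
  set f : V → ℝ := fun v => if b ≤ y v then y v - b else y v + 1 with hf
  have hf0 : ∀ v ∈ U, 0 ≤ f v := by
    intro v hv
    simp only [hf]
    split_ifs with h
    · linarith
    · linarith [hmin v hv]
  have hcU : ∀ v ∈ U, 1 - g ≤ c v ∧ c v ≤ 1 + g := fun v hv => by
    have := abs_le.1 (hc v hv)
    constructor <;> linarith
  have hcard : (G.card : ℝ) + G'.card = U.card := by
    exact_mod_cast card_filter_add_card_filter_not (s := U) (fun v => b ≤ y v)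
  have hUle : (U.card : ℝ) ≤ s := by rw [hs]; exact_mod_cast card_le_univ U
  set α : ℝ := (G'.card : ℝ) with hα
  set β : ℝ := (G.card : ℝ) with hβ
  have hα0 : 0 ≤ α := Nat.cast_nonneg _
  have hβ0 : 0 ≤ β := Nat.cast_nonneg _
  have hsum1 : ∑ v ∈ U, c v * f v = ∑ v, c v * y v - b * ∑ v ∈ G, c v + ∑ v ∈ G', c v := by
    have h1 : ∑ v, c v * y v = ∑ v ∈ U, c v * y v := by
      refine (sum_subset (subset_univ U) fun v _ hv => ?_).symm
      rw [hc0 v hv, zero_mul]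
    rw [h1, hG, hG', sum_filter, sum_filter, mul_sum, ← sum_sub_distrib, ← sum_add_distrib]
    refine sum_congr rfl fun v _ => ?_
    simp only [hf]
    split_ifs <;> ring
  have hcG : (1 - g) * β ≤ ∑ v ∈ G, c v := by
    have := card_nsmul_le_sum G c (1 - g) fun v hv => (hcU v (mem_of_mem_filter v hv)).1
    rwa [nsmul_eq_mul, mul_comm] at this
  have hcG' : ∑ v ∈ G', c v ≤ (1 + g) * α := by
    have := sum_le_card_nsmul G' c (1 + g) fun v hv => (hcU v (mem_of_mem_filter v hv)).2
    rwa [nsmul_eq_mul, mul_comm] at this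
  have hlt : ∑ v ∈ U, c v * f v < (1 + g) * α - b * ((1 - g) * β) := by
    have := mul_le_mul_of_nonneg_left hcG hbpos.le
    linarith
  have hcf0 : 0 ≤ ∑ v ∈ U, c v * f v :=
    sum_nonneg fun v hv => mul_nonneg (by linarith [(hcU v hv).1]) (hf0 v hv)
  have hε1 : ε ≤ 1 / 2400 := by linarith
  obtain ⟨hcf, hbup, hb1, hαlow⟩ := extremal_bounds hL0 hL3 hε hε1 hg0 hg hspos hα0 hβ0 hbG
    (by linarith) (by linarith) hbpos hbL hcf0 hlt
  have hfsum : ∑ v ∈ U, f v ≤ 8 * ε * s := by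
    have : ∑ v ∈ U, 1 / 2 * f v ≤ ∑ v ∈ U, c v * f v :=
      sum_le_sum fun v hv => mul_le_mul_of_nonneg_right (by linarith [(hcU v hv).1]) (hf0 v hv)
    rw [← mul_sum] at this
    linarith
  set X := U.filter fun v => δ < f v with hX
  have hXcard : (X.card : ℝ) ≤ 8 * ε / δ * s := by
    have h1 := card_nsmul_le_sum X f δ fun v hv => (mem_filter.1 hv).2.le
    have h2 : ∑ v ∈ X, f v ≤ ∑ v ∈ U, f v :=
      sum_le_sum_of_subset_of_nonneg (filter_subset _ _) fun v hv _ => hf0 v hv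
    rw [nsmul_eq_mul] at h1
    rw [div_mul_eq_mul_div, le_div_iff₀ hδ0]
    linarith
  have hδε : ε ≤ ε / δ := by
    rw [le_div_iff₀ hδ0]; linarith [mul_le_mul_of_nonneg_left (by linarith : δ ≤ 1) hε.le]
  have hA : (L - 10 * ε / δ) * s ≤ (G' \ X).card := by
    have h1 : (G'.card : ℝ) ≤ (G' \ X).card + X.card := by
      exact_mod_cast (Nat.sub_le_iff_le_add.1 (le_card_sdiff X G'))
    have h2 := mul_le_mul_of_nonneg_right hδε hspos.le
    have h3 : 10 * ε / δ = 2 * (ε / δ) + 8 * ε / δ := by ring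
    rw [h3]
    linarith
  obtain ⟨u₁, hu₁, u₂, hu₂, hne, e, he, he1, he2⟩ :=
    hpair _ (sdiff_subset.trans (filter_subset _ _)) hA
  have hlow : ∀ u ∈ G' \ X, y u ≤ -1 + δ := by
    intro u hu
    obtain ⟨h1, h2⟩ := mem_sdiff.1 hu
    obtain ⟨h3, h4⟩ := mem_filter.1 h1
    have : ¬ δ < f u := fun h => h2 (mem_filter.2 ⟨h3, h⟩)
    simp only [hf, if_neg h4] at this
    linarith
  obtain ⟨a', rfl, ha'⟩ := exists_ordering hF he he1 jr
  obtain ⟨j₂, -, hj₂⟩ := mem_image.1 he2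
  have hj₂r : j₂ ≠ jr := by
    rintro rfl
    exact hne (ha'.symm.trans hj₂)
  obtain ⟨a, ha, haJ, hamin⟩ := exists_minimal_ordering y {jr, j₂} he
  have hya1 : y (a jr) ≤ -1 + δ := by
    rw [haJ jr (by simp), ha']; exact hlow _ hu₁
  have hya2 : y (a j₂) ≤ -1 + δ := by
    rw [haJ j₂ (by simp), hj₂]; exact hlow _ hu₂
  have hyb : ∀ j ∉ ({jr, j₂} : Finset (Fin k)), y (a j) ≤ b + δ := by
    intro j hj
    by_contra! hcon
    have hsub : (univ.filter fun w => univ.image (Function.update a j w) ∈ F) ⊆ X := by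
      intro w hw
      have h1 := hamin j hj w (mem_filter.1 hw).2
      refine mem_filter.2 ⟨hnbr a j hw, ?_⟩
      simp only [hf]
      rw [if_pos (by linarith)]
      linarith
    have h1 := (hdeg a ha j).trans (Nat.cast_le.2 (card_le_card hsub))
    have h2 : 1 - L - ε ≤ 8 * ε / δ := le_of_mul_le_mul_right (h1.trans hXcard) hspos
    rw [le_div_iff₀ hδ0] at h2
    linarith [mul_le_mul_of_nonneg_right (by linarith : 1 / 2 ≤ 1 - L - ε) hδ0.le]
  have hfin := hy a ha
  have hsplit : ∑ j : Fin k, W j * (y (a j) - (b + δ)) ≤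
      W jr * (-1 - b) + W j₂ * (-1 - b) := by
    have hnotin : jr ∉ ({j₂} : Finset (Fin k)) := by simpa using hj₂r.symm
    calc _ ≤ ∑ j ∈ ({jr, j₂} : Finset (Fin k)), W j * (y (a j) - (b + δ)) := by
            rw [← sum_sdiff (subset_univ ({jr, j₂} : Finset (Fin k)))]
            refine add_le_of_nonpos_left (sum_nonpos fun j hj => ?_)
            refine mul_nonpos_of_nonneg_of_nonpos (by linarith [hWq j]) ?_
            linarith [hyb j (mem_sdiff.1 hj).2]
      _ = W jr * (y (a jr) - (b + δ)) + W j₂ * (y (a j₂) - (b + δ)) := by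
            rw [sum_insert hnotin, sum_singleton]
      _ ≤ _ := by
            refine add_le_add ?_ ?_ <;>
              refine mul_le_mul_of_nonneg_left (by linarith) (by linarith [hWq jr, hWq j₂])
  have hexp : ∑ j : Fin k, W j * (y (a j) - (b + δ)) =
      ∑ j : Fin k, W j * y (a j) - (q + 1) * t * (b + δ) := by
    simp only [mul_sub, sum_sub_distrib, ← sum_mul, hWsum]
  rw [hexp, hWr] at hsplit
  change 0 ≤ ∑ j : Fin k, W j * y (a j) at hfin
  have h1 : 1 ≤ W j₂ * (1 + b) := one_le_mul_of_one_le_of_one_le (by linarith [hWq j₂]) (by linarith)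
  have h2 : (q + 1) * ((t - 1) * b - 1) ≤ (q + 1) * (4 * (ε * t)) := by
    refine mul_le_mul_of_nonneg_left ?_ (by linarith)
    have h3 := mul_le_mul_of_nonneg_left hbup (by linarith : 0 ≤ t)
    have h4 : t * (b * (1 - L)) = b * t - b * (t * L) := by ring
    rw [h4, mul_add, hLt] at h3
    linarith
  have h3 : (q + 1) * t * (100 * ε) ≤ (q + 1) * t * δ :=
    mul_le_mul_of_nonneg_left hεδ (by positivity)
  linarith

lemma sum_mul_nonneg (hk : 2 ≤ k) (hd : 0 < d) (hdk : d < k)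
    (hF : ∀ e ∈ F, e.card = k)
    {U : Finset V} (hU : ∀ v, v ∈ U ↔ ∃ e ∈ F, v ∈ e)
    {s t ε δ g : ℝ} (hs : s = Fintype.card V) (hUs : s - 1 ≤ U.card)
    (ht : t = ((k / d * d : ℕ) : ℝ)) (ht3 : 3 ≤ t) (hε : 0 < ε) (hεδ : 100 * ε ≤ δ)
    (hδ : (k / d + 1 : ℕ) * t * δ ≤ 1 / 4) (hg0 : 0 ≤ g) (hg : g ≤ ε) (hεs : 1 ≤ ε * s)
    (hdeg : ∀ a : Fin k → V, univ.image a ∈ F → ∀ j, (1 - 1 / t - ε) * s ≤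
      (univ.filter fun w => univ.image (Function.update a j w) ∈ F).card)
    (hpair : ∀ A ⊆ U, (1 / t - 10 * ε / δ) * s ≤ A.card →
      ∃ u ∈ A, ∃ v ∈ A, u ≠ v ∧ ∃ e ∈ F, u ∈ e ∧ v ∈ e)
    {c : V → ℝ} (hc : ∀ v ∈ U, |c v - 1| ≤ g) (hc0 : ∀ v ∉ U, c v = 0) {y : V → ℝ}
    (hy : ∀ a : Fin k → V, univ.image a ∈ F → 0 ≤ ∑ j : Fin k, (weight k d j : ℝ) * y (a j)) :
    0 ≤ ∑ v, c v * y v := by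
  have hδ' : δ ≤ 1 := by
    have : (1 : ℝ) ≤ (k / d + 1 : ℕ) := by push_cast; linarith [Nat.cast_nonneg (α := ℝ) (k / d)]
    have : 1 ≤ (k / d + 1 : ℕ) * t := by nlinarith
    nlinarith
  have hcpos : ∀ v ∈ U, 0 ≤ c v := fun v hv => by linarith [(abs_le.1 (hc v hv)).1]
  by_cases hneg : ∃ v ∈ U, y v < 0
  · obtain ⟨v, hv, hyv⟩ := hneg
    obtain ⟨v₁, hv₁, hmin⟩ := exists_min_image U y ⟨v, hv⟩
    have hpos : 0 < - y v₁ := by linarith [hmin v hv]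
    have := sum_mul_nonneg_of_normalized hk hd hdk hF hU hs hUs ht ht3 hε hεδ hδ hg0 hg hεs hdeg
      hpair hc hc0 (y := fun v => y v / (- y v₁)) (fun a ha => ?_) (fun v hv => ?_) hv₁ ?_
    · simp only [← mul_div_assoc, ← sum_div] at this
      rw [le_div_iff₀ hpos, zero_mul] at this
      exact this
    · simp only [← mul_div_assoc, ← sum_div]
      exact div_nonneg (hy a ha) hpos.le
    · rw [le_div_iff₀ hpos]
      linarith [hmin v hv]
    · rw [div_neg, div_self (by linarith)]
  · push Not at hneg
    refine sum_nonneg fun v _ => ?_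
    by_cases hv : v ∈ U
    · exact mul_nonneg (hcpos v hv) (hneg v hv)
    · rw [hc0 v hv, zero_mul]

end Duality

section NonExtremal

variable {V : Type*} [Fintype V] [DecidableEq V] {k : ℕ} {F : Finset (Finset V)} {d : ℕ}

lemma card_filter_subset_le_card_update (hF : ∀ e ∈ F, e.card = k) {a : Fin k → V}
    (ha : univ.image a ∈ F) (j : Fin k) :
    (F.filter fun e => (univ.image a).erase (a j) ⊆ e).card ≤
      (univ.filter fun w => univ.image (Function.update a j w) ∈ F).card := by
  have hinj := injective_of_image_mem hF ha
  have himg : ∀ w, univ.image (Function.update a j w) = insert w ((univ.image a).erase (a j)) := by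
    intro w
    ext v
    simp only [mem_image, mem_univ, true_and, mem_insert, mem_erase]
    constructor
    · rintro ⟨i, rfl⟩
      by_cases hi : i = j
      · subst hi; simp
      · right
        rw [Function.update_of_ne hi]
        exact ⟨fun h => hi (hinj h), i, rfl⟩
    · rintro (rfl | ⟨hv, i, rfl⟩)
      · exact ⟨j, Function.update_self ..⟩
      · exact ⟨i, Function.update_of_ne (by rintro rfl; exact hv rfl) _ _⟩
  refine card_le_card_of_surjOn (fun w => univ.image (Function.update a j w)) fun e he => ?_
  obtain ⟨he, hsub⟩ := mem_filter.1 he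
  have hcard : ((univ.image a).erase (a j)).card = k - 1 := by
    rw [card_erase_of_mem (mem_image_of_mem _ (mem_univ _)), hF _ ha]
  obtain ⟨w, hw⟩ : (e \ (univ.image a).erase (a j)).Nonempty := by
    rw [← card_pos, card_sdiff_of_subset hsub, hcard, hF e he]
    have := j.pos
    omega
  obtain ⟨hwe, hw⟩ := mem_sdiff.1 hw
  have heq : univ.image (Function.update a j w) = e := by
    rw [himg]
    refine eq_of_subset_of_card_le (insert_subset hwe hsub) ?_
    rw [card_insert_of_notMem hw, hcard, hF e he]
    omega
  exact ⟨w, by simpa [heq] using he, heq⟩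

/-- If `F` has large co-degrees then so does the subgraph induced on all vertices but one. -/
lemma card_update_filter_le {T : Finset V} (hT : Fintype.card V - 1 ≤ T.card) {a : Fin k → V}
    (ha : univ.image a ∈ F.filter (· ⊆ T)) (j : Fin k) :
    (univ.filter fun w => univ.image (Function.update a j w) ∈ F).card ≤
      (univ.filter fun w => univ.image (Function.update a j w) ∈ F.filter (· ⊆ T)).card + 1 := by
  have hTc : Tᶜ.card ≤ 1 := by rw [card_compl]; omega
  refine (card_le_card (t := (univ.filter fun w =>
    univ.image (Function.update a j w) ∈ F.filter (· ⊆ T)) ∪ Tᶜ) fun w hw => ?_).trans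
    ((card_union_le _ _).trans (by omega))
  by_cases hwT : w ∈ T
  · refine mem_union_left _ (mem_filter.2 ⟨mem_univ _, mem_filter.2 ⟨(mem_filter.1 hw).2, ?_⟩⟩)
    intro v hv
    obtain ⟨i, -, rfl⟩ := mem_image.1 hv
    by_cases hi : i = j
    · rwa [hi, Function.update_self]
    · rw [Function.update_of_ne hi]
      exact (mem_filter.1 ha).2 (mem_image_of_mem _ (mem_univ _))
  · exact mem_union_right _ (mem_compl.2 hwT)

lemma exists_update_subset (hF : ∀ e ∈ F, e.card = k) {T : Finset V}
    (hT : Fintype.card V - 1 ≤ T.card) {a : Fin k → V} (ha : univ.image a ∈ F) {j : Fin k}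
    (hj : a j ∉ T)
    (hdeg : 1 < (univ.filter fun w => univ.image (Function.update a j w) ∈ F).card) :
    ∃ w ∈ T, univ.image (Function.update a j w) ∈ F.filter (· ⊆ T) := by
  have hTc : Tᶜ.card ≤ 1 := by rw [card_compl]; omega
  have hout : ∀ v ∉ T, v = a j := fun v hv =>
    card_le_one.1 hTc v (mem_compl.2 hv) (a j) (mem_compl.2 hj)
  obtain ⟨w, hw, hwj⟩ := exists_mem_ne hdeg (a j)
  have hwT : w ∈ T := by
    by_contra h
    exact hwj (hout w h)
  refine ⟨w, hwT, mem_filter.2 ⟨(mem_filter.1 hw).2, fun v hv => ?_⟩⟩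
  obtain ⟨i, -, rfl⟩ := mem_image.1 hv
  by_cases hi : i = j
  · rwa [hi, Function.update_self]
  · rw [Function.update_of_ne hi]
    by_contra h
    exact hi (injective_of_image_mem hF ha (hout _ h))

lemma exists_edge_inter_subset (hF : ∀ e ∈ F, e.card = k) {T : Finset V}
    (hT : Fintype.card V - 1 ≤ T.card)
    (hdeg : ∀ a : Fin k → V, univ.image a ∈ F → ∀ j,
      1 < (univ.filter fun w => univ.image (Function.update a j w) ∈ F).card)
    {e : Finset V} (he : e ∈ F) : ∃ e' ∈ F.filter (· ⊆ T), e ∩ T ⊆ e' := by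
  by_cases heT : e ⊆ T
  · exact ⟨e, mem_filter.2 ⟨he, heT⟩, inter_subset_left⟩
  obtain ⟨x, hxe, hxT⟩ := not_subset.1 heT
  have hk : 0 < k := by rw [← hF e he]; exact card_pos.2 ⟨x, hxe⟩
  obtain ⟨a, rfl, rfl⟩ := exists_ordering hF he hxe ⟨0, hk⟩
  obtain ⟨w, -, hw⟩ := exists_update_subset hF hT he hxT (hdeg a he _)
  refine ⟨_, hw, fun v hv => ?_⟩
  obtain ⟨hv, hvT⟩ := mem_inter.1 hv
  obtain ⟨i, -, rfl⟩ := mem_image.1 hv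
  refine mem_image.2 ⟨i, mem_univ _, Function.update_of_ne ?_ _ _⟩
  rintro rfl
  exact hxT hvT

lemma commonNeighbours_of_card_lt (hdeg : ∀ a : Fin k → V, univ.image a ∈ F → ∀ j,
      Fintype.card V < 2 * (univ.filter fun w => univ.image (Function.update a j w) ∈ F).card) :
    CommonNeighbours F k := by
  intro a b ha hb i j
  obtain ⟨w, hw⟩ := inter_nonempty_of_card_lt_card_add_card (s := (univ : Finset V))
    (filter_subset (fun w => univ.image (Function.update a i w) ∈ F) univ)
    (filter_subset (fun w => univ.image (Function.update b j w) ∈ F) univ) (by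
      rw [card_univ]
      have := hdeg a ha i
      have := hdeg b hb j
      omega)
  obtain ⟨h1, h2⟩ := mem_inter.1 hw
  exact ⟨w, (mem_filter.1 h1).2, (mem_filter.1 h2).2⟩

/-- A set slightly smaller than the sets known to contain many supported pairs still contains a
supported pair. -/
lemma exists_pair_of_card_le {t μ η ε : ℝ} (ht : 1 ≤ t) (hη : 0 ≤ η)
    (hεV : 1 ≤ ε * Fintype.card V) (hμ : η + ε < μ)
    (hpair : ∀ A : Finset V, (Fintype.card V : ℝ) / t ≤ A.card → μ * (Fintype.card V : ℝ) ^ 2 ≤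
      ((A.powersetCard 2).filter fun p => ∃ e ∈ F, p ⊆ e).card)
    {A : Finset V} (hA : (1 / t - η) * Fintype.card V ≤ A.card) :
    ∃ u ∈ A, ∃ v ∈ A, u ≠ v ∧ ∃ e ∈ F, u ∈ e ∧ v ∈ e := by
  by_contra! hno
  set s : ℝ := (Fintype.card V : ℝ) with hs
  have hs0 : 0 < s := by
    refine lt_of_le_of_ne (Nat.cast_nonneg _) fun h => ?_
    rw [← h] at hεV
    linarith
  have hst : s / t ≤ s := div_le_self hs0.le ht
  obtain ⟨A', hAA', -, hA'⟩ := exists_subsuperset_card_eq (subset_univ A)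
    (le_max_left A.card ⌈s / t⌉₊)
    (max_le (card_le_univ A) (by rw [card_univ]; exact Nat.ceil_le.2 hst))
  have hbig := hpair A' ((Nat.le_ceil _).trans (by rw [hA']; exact_mod_cast le_max_right _ _))
  have hD : ((A' \ A).card : ℝ) ≤ (η + ε) * s := by
    have h1 : ((A' \ A).card : ℝ) = A'.card - A.card := by
      rw [card_sdiff_of_subset hAA', Nat.cast_sub (card_le_card hAA')]
    have h2 : (1 / t - η) * s = s / t - η * s := by ring
    rw [h2] at hA
    rw [h1, hA', Nat.cast_max, sub_le_iff_le_add]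
    refine max_le ?_ ?_
    · nlinarith
    · have := (Nat.ceil_lt_add_one (div_nonneg hs0.le (by linarith : 0 ≤ t))).le
      linarith
  have hcount : ((A'.powersetCard 2).filter fun p => ∃ e ∈ F, p ⊆ e) ⊆
      ((A' \ A) ×ˢ (univ : Finset V)).image fun x => {x.1, x.2} := by
    intro p hp
    obtain ⟨hp, e, he, hpe⟩ := mem_filter.1 hp
    obtain ⟨hpA, hp2⟩ := mem_powersetCard.1 hp
    obtain ⟨u, v, huv, rfl⟩ := card_eq_two.1 hp2
    simp only [mem_image, mem_product, mem_univ, and_true, Prod.exists, mem_sdiff]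
    by_cases hu : u ∈ A
    · by_cases hv : v ∈ A
      · exact absurd (hpe (mem_insert_of_mem (mem_singleton_self v)))
          (hno u hu v hv huv e he (hpe (mem_insert_self _ _)))
      · exact ⟨v, u, ⟨hpA (mem_insert_of_mem (mem_singleton_self v)), hv⟩, pair_comm v u⟩
    · exact ⟨u, v, ⟨hpA (mem_insert_self _ _), hu⟩, rfl⟩
  have h1 := (card_le_card hcount).trans card_image_le
  rw [card_product, card_univ] at h1
  have h2 : μ * s ^ 2 ≤ (A' \ A).card * s := by
    refine hbig.trans ?_
    rw [hs, ← Nat.cast_mul]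
    exact Nat.cast_le.2 h1
  nlinarith [mul_le_mul_of_nonneg_right hD hs0.le, mul_pos hs0 hs0]

/-- A closed walk in `F` based at an edge inside `T` which visits the at most one vertex outside
`T` exactly once. -/
lemma exists_loop_visiting (hF : ∀ e ∈ F, e.card = k) (hk : 0 < k) (hd : 0 < d)
    {T : Finset V} (hT : Fintype.card V - 1 ≤ T.card) (hcover : ∀ v, ∃ e ∈ F, v ∈ e)
    (hdeg : ∀ a : Fin k → V, univ.image a ∈ F → ∀ j,
      1 < (univ.filter fun w => univ.image (Function.update a j w) ∈ F).card)
    {f : Fin k → V} (hf : univ.image f ∈ F.filter (· ⊆ T)) :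
    ∃ (a : Fin k → V) (h : V → ℤ), univ.image a ∈ F.filter (· ⊆ T) ∧ IsWalk F d a a h ∧
      ∀ v ∉ T, h v = 1 := by
  by_cases hTu : ∀ v, v ∈ T
  · exact ⟨f, 0, hf, IsWalk.refl hk (mem_filter.1 hf).1, fun v hv => absurd (hTu v) hv⟩
  push Not at hTu
  obtain ⟨x, hx⟩ := hTu
  have hTc : Tᶜ.card ≤ 1 := by rw [card_compl]; omega
  have hout : ∀ v ∉ T, v = x := fun v hv =>
    card_le_one.1 hTc v (mem_compl.2 hv) x (mem_compl.2 hx)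
  obtain ⟨e, he, hxe⟩ := hcover x
  obtain ⟨b, rfl, rfl⟩ := exists_ordering hF he hxe ⟨0, hk⟩
  set j : Fin k := ⟨0, hk⟩
  obtain ⟨w, hwT, hw⟩ := exists_update_subset hF hT he hx (hdeg b he _)
  have hwF := (mem_filter.1 hw).1
  have h1 := IsWalk.replace hk hwF he j (fun i hi => Function.update_of_ne hi w b)
    (x := d) (y := 0) hd (add_zero d)
  have h2 := IsWalk.replace (d := d) hk he hwF j
    (fun i hi => (Function.update_of_ne hi w b).symm) (x := 1) (y := d - 1) le_rfl (by omega)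
  refine ⟨_, _, hw, h1.trans h2, fun v hv => ?_⟩
  obtain rfl := hout v hv
  have hb : visits b (b j) = 1 := by
    rw [visits, Finset.sum_apply, sum_eq_single j]
    · simp
    · intro i _ hi
      exact Pi.single_eq_of_ne (fun h => hi (injective_of_image_mem hF he h.symm)) _
    · simp
  have hu : visits (Function.update b j w) (b j) = 0 := by
    have : b j ≠ w := by rintro h; exact hx (h ▸ hwT)
    rw [visits_update]
    simp [hb, Pi.single_eq_of_ne this]
  simp [hb, hu]

end NonExtremal

section Walk

variable {V : Type*} [Fintype V] [DecidableEq V] {k : ℕ} {F : Finset (Finset V)} {d : ℕ}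

lemma eventually_isWalk_of_nonextremal (hk : 2 ≤ k) (hd : 0 < d) (hdk : d < k)
    (hF : ∀ e ∈ F, e.card = k) (hcover : ∀ v, ∃ e ∈ F, v ∈ e) {t μ ε γ δ : ℝ}
    (ht : t = ((k / d * d : ℕ) : ℝ)) (ht3 : 3 ≤ t) (hδ0 : 0 < δ)
    (hδ : (k / d + 1 : ℕ) * t * δ ≤ 1 / 4) (hε : 0 < ε) (hμ : μ ≤ 1) (hεδ : 400 * ε ≤ μ * δ)
    (hγ : 0 < γ) (hγε : 3 * γ ≤ ε) (hεV : 1 ≤ ε * Fintype.card V)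
    (hdegF : ∀ S : Finset V, S.card = k - 1 → (∃ e ∈ F, S ⊆ e) →
      (1 - 1 / t - ε) * Fintype.card V ≤ ((F.filter fun e => S ⊆ e).card : ℝ))
    (hpair : ∀ A : Finset V, (Fintype.card V : ℝ) / t ≤ A.card → μ * (Fintype.card V : ℝ) ^ 2 ≤
      ((A.powersetCard 2).filter fun p => ∃ e ∈ F, p ⊆ e).card)
    {T : Finset V} (hT : Fintype.card V - 1 ≤ T.card) {f₁ f₂ : Fin k → V}
    (hf₁ : univ.image f₁ ∈ F.filter (· ⊆ T)) (hf₂ : univ.image f₂ ∈ F.filter (· ⊆ T)) :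
    ∀ᶠ m : ℕ in Filter.atTop, ∀ b : V → ℤ, (∀ v ∈ T, |(b v : ℝ) - m| ≤ γ * m) →
      (∀ v ∉ T, b v = 1) → (d : ℤ) ∣ ∑ v, b v - k → IsWalk F d f₁ f₂ (b - visits f₂) := by
  have hk0 : 0 < k := by omega
  set s : ℝ := (Fintype.card V : ℝ) with hs
  have hL3 : 1 / t ≤ 1 / 3 := one_div_le_one_div_of_le (by norm_num) ht3
  have hδ1 : δ ≤ 1 / 12 := by
    have h1 : (1 : ℝ) * 3 ≤ (k / d + 1 : ℕ) * t :=
      mul_le_mul (by exact_mod_cast Nat.le_add_left 1 (k / d)) ht3 (by norm_num) (by positivity)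
    linarith [mul_le_mul_of_nonneg_right h1 hδ0.le]
  have hμδ : μ * δ ≤ δ := mul_le_of_le_one_left hδ0.le hμ
  have hs0 : 0 < s := by
    by_contra h
    linarith [mul_nonpos_of_nonneg_of_nonpos hε.le (not_lt.1 h)]
  have hDs : 1 / 2 * s + 3 ≤ (1 - 1 / t - ε) * s := by
    have : (1 / 2 + 3 * ε) * s ≤ (1 - 1 / t - ε) * s :=
      mul_le_mul_of_nonneg_right (by linarith) hs0.le
    linarith
  set F' := F.filter (· ⊆ T) with hF'
  have hF'F : F' ⊆ F := filter_subset _ _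
  have hF'k : ∀ e ∈ F', e.card = k := fun e he => hF e (hF'F he)
  have hdeg : ∀ a : Fin k → V, univ.image a ∈ F → ∀ j, (1 - 1 / t - ε) * s ≤
      (univ.filter fun w => univ.image (Function.update a j w) ∈ F).card := by
    intro a ha j
    refine (hdegF ((univ.image a).erase (a j)) ?_ ⟨_, ha, erase_subset _ _⟩).trans
      (Nat.cast_le.2 (card_filter_subset_le_card_update hF ha j))
    rw [card_erase_of_mem (mem_image_of_mem _ (mem_univ _)), hF _ ha]
  have hdeg1 : ∀ a : Fin k → V, univ.image a ∈ F → ∀ j,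
      1 < (univ.filter fun w => univ.image (Function.update a j w) ∈ F).card := by
    intro a ha j
    have := hdeg a ha j
    have h : (1 : ℝ) < (univ.filter fun w => univ.image (Function.update a j w) ∈ F).card := by
      linarith
    exact_mod_cast h
  have hdeg' : ∀ a : Fin k → V, univ.image a ∈ F' → ∀ j, (1 - 1 / t - ε) * s - 1 ≤
      (univ.filter fun w => univ.image (Function.update a j w) ∈ F').card := by
    intro a ha j
    have h1 := hdeg a (hF'F ha) j
    have h2 : ((univ.filter fun w => univ.image (Function.update a j w) ∈ F).card : ℝ) ≤
        (univ.filter fun w => univ.image (Function.update a j w) ∈ F').card + 1 := by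
      exact_mod_cast card_update_filter_le hT ha j
    linarith
  have hCN : CommonNeighbours F' k := commonNeighbours_of_card_lt fun a ha j => by
    have h1 := hdeg' a ha j
    have : s < 2 * (univ.filter fun w => univ.image (Function.update a j w) ∈ F').card := by
      linarith
    rw [hs] at this
    exact_mod_cast this
  have hU : ∀ v, v ∈ T ↔ ∃ e ∈ F', v ∈ e := by
    intro v
    constructor
    · intro hv
      obtain ⟨e, he, hve⟩ := hcover v
      obtain ⟨e', he', h⟩ := exists_edge_inter_subset hF hT hdeg1 he
      exact ⟨e', he', h (mem_inter.2 ⟨hve, hv⟩)⟩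
    · rintro ⟨e, he, hv⟩
      exact (mem_filter.1 he).2 hv
  have hU' : ∀ v, v ∉ T ↔ ∀ e ∈ F', v ∉ e := fun v => by rw [hU]; push Not; rfl
  have hpair' : ∀ A ⊆ T, (1 / t - 10 * (2 * ε) / δ) * s ≤ A.card →
      ∃ u ∈ A, ∃ v ∈ A, u ≠ v ∧ ∃ e ∈ F', u ∈ e ∧ v ∈ e := by
    intro A hAT hA
    have hη : 10 * (2 * ε) / δ + ε < μ := by
      have h1 : 10 * (2 * ε) / δ ≤ μ / 20 := by
        rw [div_le_iff₀ hδ0]; linarith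
      have h2 : 0 < μ := pos_of_mul_pos_left (by linarith : 0 < μ * δ) hδ0.le
      have h3 : μ * δ ≤ μ * 1 := mul_le_mul_of_nonneg_left (by linarith) h2.le
      linarith
    obtain ⟨u, hu, v, hv, huv, e, he, hue, hve⟩ := exists_pair_of_card_le (by linarith : 1 ≤ t)
      (by positivity) hεV hη hpair hA
    obtain ⟨e', he', h⟩ := exists_edge_inter_subset hF hT hdeg1 he
    exact ⟨u, hu, v, hv, huv, e', he', h (mem_inter.2 ⟨hue, hAT hu⟩),
      h (mem_inter.2 ⟨hve, hAT hv⟩)⟩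
  obtain ⟨a, h, ha, hah, hh⟩ := exists_loop_visiting hF hk0 hd hT hcover hdeg1 hf₁
  obtain ⟨x₁, hx₁, -⟩ := hCN.exists_walk hk0 hd hf₁ ha
  obtain ⟨x₂, hx₂, -⟩ := hCN.exists_walk hk0 hd ha hf₂
  have hTs : s - 1 ≤ T.card := by
    rw [hs, sub_le_iff_le_add]
    exact_mod_cast Nat.sub_le_iff_le_add.1 hT
  have key := hCN.eventually_isWalk hk0 hd hdk.le hF'k ha hγ (by linarith) fun c hc hc0 y hy =>
    sum_mul_nonneg (ε := 2 * ε) (δ := δ) (g := 3 * γ) hk hd hdk hF'k hU hs hTs ht ht3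
      (by linarith) (by linarith) hδ (by linarith) (by linarith) (by linarith)
      (fun a ha j => by linarith [hdeg' a ha j]) hpair' (fun v hv => hc v ((hU v).1 hv))
      (fun v hv => hc0 v ((hU' v).1 hv)) hy
  set o : V → ℤ := visits f₂ + x₁ + h + x₂ with ho
  obtain ⟨C, hC⟩ : ∃ C : ℝ, ∀ v, |(o v : ℝ)| ≤ C :=
    ⟨∑ v, |(o v : ℝ)|, fun v =>
      single_le_sum (f := fun v => |(o v : ℝ)|) (fun _ _ => abs_nonneg _) (mem_univ v)⟩
  have hlarge : ∀ᶠ m : ℕ in Filter.atTop, C ≤ γ * m :=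
    (tendsto_natCast_atTop_atTop.const_mul_atTop hγ).eventually_ge_atTop C
  filter_upwards [key, hlarge] with m hm hmC b hb hb1 hbd
  have hz : IsWalk F' d a a (b - o) := by
    refine hm _ (fun v hv => ?_) (fun v hv => ?_) ?_
    · rw [Pi.sub_apply, Int.cast_sub]
      have h1 := abs_le.1 (hb v ((hU v).2 hv))
      have h2 := abs_le.1 (hC v)
      exact abs_le.2 ⟨by linarith, by linarith⟩
    · have hvT := (hU' v).2 hv
      have h1 : visits f₂ v = 0 := by
        rw [visits, Finset.sum_apply]
        refine sum_eq_zero fun j _ => Pi.single_eq_of_ne ?_ _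
        rintro rfl
        exact hv _ hf₂ (mem_image_of_mem _ (mem_univ _))
      simp [ho, hb1 v hvT, hh v hvT, h1, hx₁.eq_zero hd hdk.le hv, hx₂.eq_zero hd hdk.le hv]
    · simp only [ho, Pi.sub_apply, Pi.add_apply, sum_sub_distrib, sum_add_distrib, sum_visits]
      have h1 := hx₁.dvd_sum
      have h2 := hx₂.dvd_sum
      have h3 := hah.dvd_sum
      have h4 := ((hbd.sub h1).sub h3).sub h2
      rwa [sub_sub, sub_sub, sub_sub, ← add_assoc, ← add_assoc] at h4
  have := (((hx₁.mono hF'F).trans hah).trans (hz.mono hF'F)).trans (hx₂.mono hF'F)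
  convert this using 1
  rw [ho]
  abel

end Walk

section Lifting

variable {s n k : ℕ} {F : Finset (Finset (Fin s))} {B : Fin s → Finset (Fin n)}

lemma IsBlowUpEdge.exists_projection
    (hdisj : ∀ u v : Fin s, u ≠ v → Disjoint (B u) (B v)) {e : Fin k → Fin n}
    (he : IsBlowUpEdge F B (image e univ)) :
    ∃ f : Fin k → Fin s, univ.image f ∈ F ∧ ∀ j, e j ∈ B (f j) := by
  obtain ⟨f₀, hf₀, hsub, hone⟩ := he
  have : ∀ j, ∃ v ∈ f₀, e j ∈ B v := fun j => by
    simpa using hsub (mem_image_of_mem e (mem_univ j))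
  choose f hf hef using this
  refine ⟨f, ?_, hef⟩
  convert hf₀ using 1
  refine Subset.antisymm (image_subset_iff.2 fun j _ => hf j) fun v hv => ?_
  obtain ⟨x, hx⟩ := card_pos.1 (by rw [hone v hv]; norm_num : 0 < (image e univ ∩ B v).card)
  obtain ⟨hx, hxv⟩ := mem_inter.1 hx
  obtain ⟨j, -, rfl⟩ := mem_image.1 hx
  refine mem_image.2 ⟨j, mem_univ _, ?_⟩
  by_contra h
  exact disjoint_left.1 (hdisj _ _ h) (hef j) hxv

/-- A sequence of parts visiting every part as often as its size lifts to a sequence of vertices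
visiting every vertex exactly once, with prescribed values on a set `K` of positions. -/
lemma exists_lift {w : Fin n → Fin s} (hcard : ∀ v, (univ.filter fun i => w i = v).card = (B v).card)
    (hdisj : ∀ u v : Fin s, u ≠ v → Disjoint (B u) (B v)) {K : Finset (Fin n)} {g : Fin n → Fin n}
    (hg : ∀ i ∈ K, g i ∈ B (w i)) (hinj : Set.InjOn g K) :
    ∃ p : Fin n → Fin n, Function.Injective p ∧ (∀ i, p i ∈ B (w i)) ∧ ∀ i ∈ K, p i = g i := by
  have : ∀ v, ∃ φ : {i // w i = v} ≃ B v, ∀ i ∈ K.subtype (w · = v), (φ i : Fin n) = g i := by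
    intro v
    refine exists_equiv_extend_of_card_eq (f := fun i : {i // w i = v} => g i) ?_ ?_ ?_
    · rw [Fintype.card_subtype, hcard]
    · rintro _ hx
      obtain ⟨i, hi, rfl⟩ := mem_image.1 hx
      have := hg i (mem_subtype.1 hi)
      rwa [i.2] at this
    · intro i hi i' hi' h
      exact Subtype.ext (hinj (mem_subtype.1 hi) (mem_subtype.1 hi') h)
  choose φ hφ using this
  refine ⟨fun i => φ (w i) ⟨i, rfl⟩, fun i i' h => ?_, fun i => (φ (w i) ⟨i, rfl⟩).2, fun i hi =>
    hφ _ ⟨i, rfl⟩ (mem_subtype.2 hi)⟩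
  have hw : w i = w i' := by
    by_contra hne
    refine disjoint_left.1 (hdisj _ _ hne) (φ (w i) ⟨i, rfl⟩).2 ?_
    simp only at h
    rw [h]
    exact (φ (w i') ⟨i', rfl⟩).2
  have key : ∀ v (h1 : w i = v) (h2 : w i' = v), (φ v ⟨i, h1⟩ : Fin n) = φ v ⟨i', h2⟩ → i = i' :=
    fun v h1 h2 h => congrArg Subtype.val ((φ v).injective (Subtype.ext h))
  refine key (w i') hw rfl ?_
  have : ∀ v (h1 : w i = v), (φ v ⟨i, h1⟩ : Fin n) = φ (w i) ⟨i, rfl⟩ := by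
    rintro _ rfl; rfl
  rw [this]
  exact h

lemma isBlowUpEdge_of_image_mem (hF : ∀ e ∈ F, e.card = k)
    (hdisj : ∀ u v : Fin s, u ≠ v → Disjoint (B u) (B v)) {a : Fin k → Fin s}
    (ha : univ.image a ∈ F) {e : Fin k → Fin n} (he : ∀ j, e j ∈ B (a j)) :
    IsBlowUpEdge F B (image e univ) := by
  refine ⟨_, ha, ?_, ?_⟩
  · intro x hx
    obtain ⟨j, -, rfl⟩ := mem_image.1 hx
    exact mem_biUnion.2 ⟨a j, mem_image_of_mem _ (mem_univ _), he j⟩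
  · intro v hv
    obtain ⟨j, -, rfl⟩ := mem_image.1 hv
    refine card_eq_one.2 ⟨e j, ?_⟩
    ext x
    simp only [mem_inter, mem_image, mem_univ, true_and, mem_singleton]
    constructor
    · rintro ⟨⟨i, rfl⟩, hi⟩
      have : a i = a j := by
        by_contra h
        exact disjoint_left.1 (hdisj _ _ h) (he i) hi
      exact congrArg e (injective_of_image_mem hF ha this)
    · rintro rfl
      exact ⟨⟨j, rfl⟩, he j⟩

lemma exists_spanning_path (hF : ∀ e ∈ F, e.card = k) (hk : 0 < k) {d : ℕ} (hd : 0 < d)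
    (hdisj : ∀ u v : Fin s, u ≠ v → Disjoint (B u) (B v)) (hcov : univ.biUnion B = univ)
    {e₁ e₂ : Fin k → Fin n} (he₁ : Function.Injective e₁) (he₂ : Function.Injective e₂)
    (hne : ∀ i j, e₁ i ≠ e₂ j) {f₁ f₂ : Fin k → Fin s} (hf₁ : ∀ j, e₁ j ∈ B (f₁ j))
    (hf₂ : ∀ j, e₂ j ∈ B (f₂ j))
    (hwalk : IsWalk F d f₁ f₂ ((fun v => ((B v).card : ℤ)) - visits f₂)) :
    ∃ p : ℕ → Fin n,
      (∀ i j : ℕ, i < n → j < n → p i = p j → i = j) ∧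
      (∀ i : ℕ, i * d + k ≤ n →
        IsBlowUpEdge F B (image (fun j : Fin k => p (i * d + (j : ℕ))) univ)) ∧
      (∀ j : Fin k, p (j : ℕ) = e₁ j) ∧ ∀ j : Fin k, p (n - k + (j : ℕ)) = e₂ j := by
  obtain ⟨N, w, hw₁, hw₂, hwF, hcount⟩ := hwalk
  have hBn : ∑ v, (B v).card = n := by
    rw [← card_biUnion fun u _ v _ h => hdisj u v h, hcov, card_univ, Fintype.card_fin]
  have h2k : 2 * k ≤ n := by
    have := Fintype.card_le_of_injective _ (he₁.sumElim he₂ hne)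
    simp only [Fintype.card_sum, Fintype.card_fin] at this
    omega
  have hnN : n = N * d + k := by
    have h := congrArg (fun x : Fin s → ℤ => ∑ v, x v) hcount
    simp only [Pi.sub_apply, sum_sub_distrib, sum_visits, Finset.sum_apply] at h
    rw [sum_comm, ← Nat.cast_sum, hBn] at h
    simp only [sum_pi_single', mem_univ, if_true, sum_const, card_range, nsmul_eq_mul,
      mul_one] at h
    omega
  subst hnN
  have hcard : ∀ v, (univ.filter fun i : Fin (N * d + k) => w i = v).card = (B v).card := by
    intro v
    have h := congrFun hcount v
    rw [Pi.sub_apply, sub_eq_iff_eq_add, visits, Finset.sum_apply, Finset.sum_apply] at h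
    simp only [← hw₂] at h
    rw [Fin.sum_univ_eq_sum_range (fun j => (Pi.single (w (N * d + j)) (1 : ℤ) : Fin s → ℤ) v),
      ← sum_range_add (fun i => (Pi.single (w i) (1 : ℤ) : Fin s → ℤ) v),
      ← Fin.sum_univ_eq_sum_range (fun i => (Pi.single (w i) (1 : ℤ) : Fin s → ℤ) v)] at h
    zify
    rw [h, card_filter, Nat.cast_sum]
    refine sum_congr rfl fun i _ => ?_
    simp [Pi.single_apply, eq_comm]
  set g : Fin (N * d + k) → Fin (N * d + k) := fun i =>
    if h : (i : ℕ) < k then e₁ ⟨i, h⟩ else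
      if N * d ≤ i then e₂ ⟨i - N * d, by omega⟩ else i with hgdef
  have hg₁ : ∀ i : Fin (N * d + k), ∀ h : (i : ℕ) < k, g i = e₁ ⟨i, h⟩ := fun i h => dif_pos h
  have hg₂ : ∀ i : Fin (N * d + k), N * d ≤ i → g i = e₂ ⟨i - N * d, by omega⟩ := fun i h => by
    rw [hgdef]
    simp only
    rw [dif_neg (by omega), if_pos h]
  obtain ⟨p, hpinj, hpB, hpK⟩ := exists_lift (w := fun i => w i) hcard hdisj (g := g)
    (K := univ.filter fun i => (i : ℕ) < k ∨ N * d ≤ i) (by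
      intro i hi
      rcases (mem_filter.1 hi).2 with h | h
      · rw [hg₁ i h]
        have := hf₁ ⟨i, h⟩
        rwa [← hw₁] at this
      · rw [hg₂ i h]
        have := hf₂ ⟨i - N * d, by omega⟩
        rwa [← hw₂, Nat.add_sub_cancel' h] at this) (by
      intro i hi i' hi' h
      rcases (mem_filter.1 hi).2 with hi | hi <;> rcases (mem_filter.1 hi').2 with hi' | hi'
      · rw [hg₁ i hi, hg₁ i' hi'] at h
        have := congrArg Fin.val (he₁ h)
        exact Fin.ext this
      · rw [hg₁ i hi, hg₂ i' hi'] at h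
        exact absurd h (hne _ _)
      · rw [hg₂ i hi, hg₁ i' hi'] at h
        exact absurd h.symm (hne _ _)
      · rw [hg₂ i hi, hg₂ i' hi'] at h
        have := congrArg Fin.val (he₂ h)
        simp only at this
        exact Fin.ext (by omega))
  have hpos : 0 < N * d + k := by omega
  set p' : ℕ → Fin (N * d + k) := fun i => if h : i < N * d + k then p ⟨i, h⟩ else p ⟨0, hpos⟩
    with hp'
  have hp : ∀ i (h : i < N * d + k), p' i = p ⟨i, h⟩ := fun i h => dif_pos h
  refine ⟨p', fun i j hi hj h => ?_, fun i hi => ?_, fun j => ?_, fun j => ?_⟩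
  · rw [hp i hi, hp j hj] at h
    exact congrArg Fin.val (hpinj h)
  · have hiN : i ≤ N := Nat.le_of_mul_le_mul_right (by omega : i * d ≤ N * d) hd
    refine isBlowUpEdge_of_image_mem hF hdisj (hwF i hiN) fun j => ?_
    rw [hp _ (by omega)]
    exact hpB _
  · rw [hp _ (by omega), hpK _ (by simp), hg₁ _ j.2]
  · rw [Nat.add_sub_cancel, hp _ (by omega), hpK _ (by simp), hg₂ _ (by simp)]
    simp

end Lifting

/-- Spanning ℓ-paths with prescribed first and last ordered edges in
nearly-regular blow-ups of non-extremal hypergraphs. The blow-up `F*` of `F`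
lives on `Fin n`, its parts `B v` partitioning `Fin n`. -/
theorem hamilton_ell_path_in_blowup
    (k l t : ℕ) (hk : 3 ≤ k) (hl : 1 ≤ l) (hlk : l ≤ k - 1)
    (hne : ¬(k = 3 ∧ l = 1)) (ht : t = k / (k - l) * (k - l)) :
    ∃ μ₀ : ℝ, 0 < μ₀ ∧ ∀ μ : ℝ, 0 < μ → μ ≤ μ₀ →
    ∃ ε₀ : ℝ, 0 < ε₀ ∧ ∀ ε : ℝ, 0 < ε → ε ≤ ε₀ →
    ∃ γ₀ : ℝ, 0 < γ₀ ∧ ∀ γ : ℝ, 0 < γ → γ ≤ γ₀ →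
    ∃ s₀ : ℕ, ∀ s : ℕ, s₀ ≤ s → (k - l) ∣ s →
    ∃ m₀ : ℕ, ∀ m : ℕ, m₀ ≤ m →
    ∀ n : ℕ, ∀ F : Finset (Finset (Fin s)), ∀ B : Fin s → Finset (Fin n),
      -- `F` is an `s`-vertex `k`-graph, non-extremal:
      (∀ e ∈ F, e.card = k) →
      (∀ v : Fin s, ∃ e ∈ F, v ∈ e) →
      (∀ S : Finset (Fin s), S.card = k - 1 → (∃ e ∈ F, S ⊆ e) →
        (1 - 1 / (t : ℝ) - ε) * (s : ℝ) ≤ ((F.filter fun e => S ⊆ e).card : ℝ)) →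
      (∀ A : Finset (Fin s), (s : ℝ) / (t : ℝ) ≤ (A.card : ℝ) →
        μ * (s : ℝ) ^ 2 ≤ (suppPairs F A : ℝ)) →
      -- the parts `B v` form a `(γ,m)`-nearly-regular blow-up partitioning `Fin n`:
      (∀ u v : Fin s, u ≠ v → Disjoint (B u) (B v)) →
      Finset.univ.biUnion B = (Finset.univ : Finset (Fin n)) →
      (∃ T : Finset (Fin s), (s - 1 : ℕ) ≤ T.card ∧
        (∀ v ∈ T, (1 - γ) * (m : ℝ) ≤ ((B v).card : ℝ) ∧
          ((B v).card : ℝ) ≤ (1 + γ) * (m : ℝ)) ∧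
        ∀ v ∉ T, (B v).card = 1) →
      -- `|V(F*)| ≡ k (mod k - ℓ)`:
      n % (k - l) = k % (k - l) →
      -- two ordered edges of `F*`, vertex-disjoint from each other and from
      -- the singleton part (if it exists):
      ∀ e₁ e₂ : Fin k → Fin n,
        Function.Injective e₁ → IsBlowUpEdge F B (Finset.image e₁ Finset.univ) →
        Function.Injective e₂ → IsBlowUpEdge F B (Finset.image e₂ Finset.univ) →
        (∀ i j : Fin k, e₁ i ≠ e₂ j) →
        (∀ v : Fin s, (B v).card = 1 → ∀ i : Fin k, e₁ i ∉ B v ∧ e₂ i ∉ B v) →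
        -- conclusion: a spanning ℓ-path of `F*` from `e₁` to `e₂`
        ∃ p : ℕ → Fin n,
          (∀ i j : ℕ, i < n → j < n → p i = p j → i = j) ∧
          (∀ i : ℕ, i * (k - l) + k ≤ n →
            IsBlowUpEdge F B
              (Finset.image (fun j : Fin k => p (i * (k - l) + (j : ℕ))) Finset.univ)) ∧
          (∀ j : Fin k, p (j : ℕ) = e₁ j) ∧
          (∀ j : Fin k, p (n - k + (j : ℕ)) = e₂ j) := by
  set d := k - l with hd_def
  have hd : 0 < d := by omega
  have hdk : d < k := by omega
  have htN : 3 ≤ t := by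
    have h1 := Nat.div_add_mod' k d
    have h2 := Nat.mod_lt k hd
    have h3 : 1 * d ≤ k / d * d := Nat.mul_le_mul_right d (Nat.div_pos hdk.le hd)
    omega
  have ht3 : (3 : ℝ) ≤ t := by exact_mod_cast htN
  set δ : ℝ := 1 / (4 * ((k / d + 1 : ℕ) * (t : ℝ))) with hδ_def
  have hδ0 : 0 < δ := by positivity
  have hδ : (k / d + 1 : ℕ) * (t : ℝ) * δ ≤ 1 / 4 := by
    rw [hδ_def]
    field_simp
    exact le_rfl
  refine ⟨1, one_pos, fun μ hμ0 hμ => ⟨μ * δ / 400, by positivity, fun ε hε hεδ =>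
    ⟨ε / 3, by positivity, fun γ hγ hγε => ⟨⌈1 / ε⌉₊, fun s hs _ => ?_⟩⟩⟩⟩
  have hεs : 1 ≤ ε * s := by
    rw [mul_comm, ← div_le_iff₀ hε]
    exact (Nat.le_ceil _).trans (Nat.cast_le.2 hs)
  have hev : ∀ᶠ m : ℕ in Filter.atTop, ∀ (F : Finset (Finset (Fin s))) (T : Finset (Fin s))
      (f₁ f₂ : Fin k → Fin s), (∀ e ∈ F, e.card = k) → (∀ v : Fin s, ∃ e ∈ F, v ∈ e) →
      (∀ S : Finset (Fin s), S.card = k - 1 → (∃ e ∈ F, S ⊆ e) →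
        (1 - 1 / (t : ℝ) - ε) * (s : ℝ) ≤ ((F.filter fun e => S ⊆ e).card : ℝ)) →
      (∀ A : Finset (Fin s), (s : ℝ) / (t : ℝ) ≤ (A.card : ℝ) →
        μ * (s : ℝ) ^ 2 ≤ (suppPairs F A : ℝ)) →
      (s - 1 : ℕ) ≤ T.card → univ.image f₁ ∈ F.filter (· ⊆ T) →
      univ.image f₂ ∈ F.filter (· ⊆ T) → ∀ b : Fin s → ℤ,
      (∀ v ∈ T, |(b v : ℝ) - m| ≤ γ * m) → (∀ v ∉ T, b v = 1) → (d : ℤ) ∣ ∑ v, b v - k →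
      IsWalk F d f₁ f₂ (b - visits f₂) := by
    simp only [Filter.eventually_all]
    intro F T f₁ f₂ hF hcover hdeg hpair hT hf₁ hf₂
    have hs' : (s : ℝ) = (Fintype.card (Fin s) : ℕ) := by rw [Fintype.card_fin]
    refine eventually_isWalk_of_nonextremal (t := t) (μ := μ) (ε := ε) (δ := δ) (by omega) hd hdk hF
      hcover (by rw [ht]) ht3 hδ0 hδ hε hμ (by linarith) hγ (by linarith) ?_ ?_ ?_ ?_ hf₁ hf₂
    · rwa [← hs']
    · rwa [← hs']
    · rw [← hs']
      exact hpair
    · rwa [Fintype.card_fin]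
  obtain ⟨m₀, hm₀⟩ := Filter.eventually_atTop.1 hev
  refine ⟨m₀, fun m hm n F B hF hcover hdeg hpair hdisj hcov hparts hn e₁ e₂ he₁ hb₁ he₂ hb₂ hne
    hsing => ?_⟩
  obtain ⟨T, hT, hTbig, hTone⟩ := hparts
  obtain ⟨f₁, hf₁, hef₁⟩ := hb₁.exists_projection hdisj
  obtain ⟨f₂, hf₂, hef₂⟩ := hb₂.exists_projection hdisj
  have hmem₁ : univ.image f₁ ∈ F.filter (· ⊆ T) := by
    refine mem_filter.2 ⟨hf₁, image_subset_iff.2 fun j _ => ?_⟩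
    by_contra h
    exact (hsing _ (hTone _ h) j).1 (hef₁ j)
  have hmem₂ : univ.image f₂ ∈ F.filter (· ⊆ T) := by
    refine mem_filter.2 ⟨hf₂, image_subset_iff.2 fun j _ => ?_⟩
    by_contra h
    exact (hsing _ (hTone _ h) j).2 (hef₂ j)
  refine exists_spanning_path hF (by omega) hd hdisj hcov he₁ he₂ hne hef₁ hef₂
    (hm₀ m hm F T f₁ f₂ hF hcover hdeg hpair hT hmem₁ hmem₂ _ (fun v hv => ?_)
      (fun v hv => by rw [hTone v hv, Nat.cast_one]) ?_)
  · obtain ⟨h1, h2⟩ := hTbig v hv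
    rw [Int.cast_natCast]
    exact abs_le.2 ⟨by linarith, by linarith⟩
  · rw [← Nat.cast_sum, ← card_biUnion fun u _ v _ h => hdisj u v h, hcov, card_univ,
      Fintype.card_fin]
    exact Nat.modEq_iff_dvd.1 hn.symm
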